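/- There exist absolute constants C5 > 0 and C6 > 0 such that the following holds. Fix integers p ≥ 1 (number of sources), n ≥ 2 (channel length), m ≥ n (probe length), and a sparsity level s ≥ 2. Let Φ be the random m × (np) multichannel probe matrix built from i.i.d. N(0, 1/m) probe samples. If m ≥ C6 · s · (log s)² · (log(mp))² · log(np), then E‖I − Φ*Φ‖_s ≤ √( C5 · s · (log s)² · (log(mp))² · log(np) / m ). -/

import Mathlib

open MeasureTheory ProbabilityTheory Matrix

/-- The `s`-norm of a square complex matrix: the supremum of `|y* A x|` over index
sets `Γ` of cardinality at most `s` and unit-`ℓ₂`-norm vectors `x, y` supported on `Γ`. -/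
noncomputable def snormS {ι : Type*} [Fintype ι] (s : ℕ) (A : Matrix ι ι ℂ) : ℝ :=
  sSup {r : ℝ | ∃ (Γ : Finset ι) (x y : ι → ℂ),
    Γ.card ≤ s ∧ (∀ i, i ∉ Γ → x i = 0) ∧ (∀ i, i ∉ Γ → y i = 0) ∧
    (∑ i, ‖x i‖ ^ 2) = 1 ∧ (∑ i, ‖y i‖ ^ 2) = 1 ∧
    r = ‖dotProduct (star y) (A.mulVec x)‖}

/-- Law of `p·m` i.i.d. real Gaussian probe samples of mean `0` and variance `1/m`. -/
noncomputable def gaussMeasure (p m : ℕ) : Measure (Fin p → Fin m → ℝ) :=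
  Measure.pi fun _ => Measure.pi fun _ => gaussianReal 0 ((m : NNReal))⁻¹

/-- The `m × (np)` multichannel probe matrix: the `i`-th block is the first `n`
columns of the `m × m` circulant matrix with first row
`(φ_i(n), φ_i(n−1), …, φ_i(1), φ_i(m), …, φ_i(n+1))`. -/
def probeMatrix (p n m : ℕ) (φ : Fin p → Fin m → ℝ) :
    Matrix (Fin m) (Fin p × Fin n) ℝ :=
  Matrix.of fun j ik => φ ik.1 ⟨(n - 1 - (ik.2 : ℕ) + (j : ℕ)) % m, Nat.mod_lt _ j.pos⟩

/-- Sign attached to a Boolean. -/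
noncomputable def bsgn (b : Bool) : ℝ := if b then 1 else -1

lemma rad_mgf {R : Type*} [Fintype R] [DecidableEq R] (c : R → ℝ) :
    ∑ η : R → Bool, Real.exp (∑ r, bsgn (η r) * c r)
      ≤ 2 ^ Fintype.card R * Real.exp ((∑ r, c r ^ 2) / 2) := by
  have h1 : ∑ η : R → Bool, Real.exp (∑ r, bsgn (η r) * c r)
      = ∏ r, ∑ b : Bool, Real.exp (bsgn b * c r) := by
    rw [Fintype.prod_sum]
    refine Finset.sum_congr rfl fun η _ => ?_
    rw [Real.exp_sum]
  rw [h1]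
  calc ∏ r, ∑ b : Bool, Real.exp (bsgn b * c r)
      ≤ ∏ r, (2 * Real.exp (c r ^ 2 / 2)) := by
        refine Finset.prod_le_prod (fun r _ => Finset.sum_nonneg fun b _ => (Real.exp_pos _).le) ?_
        intro r _
        have := Real.cosh_le_exp_half_sq (c r)
        rw [Real.cosh_eq] at this
        simp [bsgn]
        linarith
    _ = _ := by
        rw [Finset.prod_mul_distrib, Finset.sum_div, Real.exp_sum]
        simp

lemma le_log_add_exp (t A : ℝ) (hA : 0 < A) : t ≤ Real.log A + Real.exp t / A - 1 := by
  have := Real.add_one_le_exp (t - Real.log A)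
  rw [Real.exp_sub, Real.exp_log hA] at this
  linarith

lemma rad_max {R α : Type*} [Fintype R] [DecidableEq R] (J : Finset α)
    (c : α → R → ℝ) (σ H : ℝ) (hσ : 0 < σ) (hH : 0 < H)
    (hc : ∀ j ∈ J, ∑ r, c j r ^ 2 ≤ σ ^ 2) (hJ : Real.log (2 * J.card) ≤ H)
    (F : (R → Bool) → ℝ) (hF : ∀ η, ∃ j ∈ J, F η ≤ |∑ r, bsgn (η r) * c j r|) :
    ∑ η, F η ≤ 2 ^ Fintype.card R * (3 / 2 * σ * Real.sqrt H) := by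
  have hJpos : 0 < (J.card : ℝ) := by
    obtain ⟨j, hj, _⟩ := hF (fun _ => true)
    exact_mod_cast Finset.card_pos.mpr ⟨j, hj⟩
  set l : ℝ := Real.sqrt H / σ with hl
  have hlpos : 0 < l := by positivity
  set A : ℝ := 2 * J.card * Real.exp (H / 2) with hA
  have hApos : 0 < A := by positivity
  have hlogA : Real.log A ≤ 3 / 2 * H := by
    rw [hA, Real.log_mul (by positivity) (by positivity), Real.log_exp]; linarith
  have key : ∀ η, l * F η ≤ Real.log A - 1 +
      (∑ j ∈ J, (Real.exp (∑ r, bsgn (η r) * (l * c j r)) +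
        Real.exp (∑ r, bsgn (η r) * (-l * c j r)))) / A := by
    intro η
    obtain ⟨j, hj, h⟩ := hF η
    have h1 : l * F η ≤ |∑ r, bsgn (η r) * (l * c j r)| := by
      have : ∑ r, bsgn (η r) * (l * c j r) = l * ∑ r, bsgn (η r) * c j r := by
        rw [Finset.mul_sum]; exact Finset.sum_congr rfl fun r _ => by ring
      rw [this, abs_mul, abs_of_pos hlpos]
      exact mul_le_mul_of_nonneg_left h hlpos.le
    have h2 := le_log_add_exp (l * F η) A hApos
    have h3 : Real.exp (l * F η) ≤ Real.exp (∑ r, bsgn (η r) * (l * c j r)) +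
        Real.exp (∑ r, bsgn (η r) * (-l * c j r)) := by
      have e : ∑ r, bsgn (η r) * (-l * c j r) = - ∑ r, bsgn (η r) * (l * c j r) := by
        rw [← Finset.sum_neg_distrib]; exact Finset.sum_congr rfl fun r _ => by ring
      rw [e]
      refine (Real.exp_le_exp.mpr h1).trans ?_
      rcases abs_cases (∑ r, bsgn (η r) * (l * c j r)) with ⟨h, _⟩ | ⟨h, _⟩ <;> rw [h]
      · linarith [Real.exp_pos (-∑ r, bsgn (η r) * (l * c j r))]
      · linarith [Real.exp_pos (∑ r, bsgn (η r) * (l * c j r))]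
    have h4 : Real.exp (l * F η) ≤ ∑ j ∈ J, (Real.exp (∑ r, bsgn (η r) * (l * c j r)) +
        Real.exp (∑ r, bsgn (η r) * (-l * c j r))) :=
      h3.trans (Finset.single_le_sum (f := fun j => (Real.exp (∑ r, bsgn (η r) * (l * c j r)) +
        Real.exp (∑ r, bsgn (η r) * (-l * c j r)))) (fun j _ => by positivity) hj)
    have h5 := div_le_div_of_nonneg_right h4 hApos.le
    linarith
  have hsum := Finset.sum_le_sum (s := Finset.univ) fun η _ => key η
  rw [← Finset.mul_sum, Finset.sum_add_distrib, ← Finset.sum_div, Finset.sum_comm] at hsum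
  have hb : ∑ j ∈ J, ∑ η : R → Bool, (Real.exp (∑ r, bsgn (η r) * (l * c j r)) +
        Real.exp (∑ r, bsgn (η r) * (-l * c j r))) ≤ 2 ^ Fintype.card R * A := by
    have : ∀ j ∈ J, ∑ η : R → Bool, (Real.exp (∑ r, bsgn (η r) * (l * c j r)) +
        Real.exp (∑ r, bsgn (η r) * (-l * c j r))) ≤
        2 ^ Fintype.card R * (2 * Real.exp (H / 2)) := by
      intro j hj
      rw [Finset.sum_add_distrib]
      have a1 := rad_mgf (fun r => l * c j r)
      have a2 := rad_mgf (fun r => -l * c j r)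
      have e1 : ∑ r, (l * c j r) ^ 2 = l ^ 2 * ∑ r, c j r ^ 2 := by
        rw [Finset.mul_sum]; exact Finset.sum_congr rfl fun r _ => by ring
      have e2 : ∑ r, (-l * c j r) ^ 2 = l ^ 2 * ∑ r, c j r ^ 2 := by
        rw [Finset.mul_sum]; exact Finset.sum_congr rfl fun r _ => by ring
      rw [e1] at a1
      rw [e2] at a2
      have e3 : l ^ 2 * ∑ r, c j r ^ 2 ≤ H := by
        calc l ^ 2 * ∑ r, c j r ^ 2 ≤ l ^ 2 * σ ^ 2 := by
              gcongr; exact hc j hj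
          _ = H := by
              rw [hl, div_pow, Real.sq_sqrt hH.le]; field_simp
      have e4 : Real.exp (l ^ 2 * (∑ r, c j r ^ 2) / 2) ≤ Real.exp (H / 2) := by
        gcongr
      have e5 : (2 : ℝ) ^ Fintype.card R * Real.exp (l ^ 2 * (∑ r, c j r ^ 2) / 2) ≤
        2 ^ Fintype.card R * Real.exp (H / 2) := by gcongr
      linarith
    refine (Finset.sum_le_sum this).trans (le_of_eq ?_)
    rw [Finset.sum_const, nsmul_eq_mul, hA]; ring
  have hb2 := div_le_div_of_nonneg_right hb hApos.le
  rw [mul_div_cancel_right₀ _ hApos.ne'] at hb2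
  have hcard : ∑ _η : R → Bool, (Real.log A - 1) = 2 ^ Fintype.card R * (Real.log A - 1) := by
    simp only [Finset.sum_const, nsmul_eq_mul]
    simp
  rw [hcard] at hsum
  have hfin : l * ∑ η, F η ≤ 2 ^ Fintype.card R * (3 / 2 * H) := by
    have : (2 : ℝ) ^ Fintype.card R * Real.log A ≤ 2 ^ Fintype.card R * (3 / 2 * H) := by gcongr
    linarith
  have hHs : H = Real.sqrt H * Real.sqrt H := (Real.mul_self_sqrt hH.le).symm
  have : l * ∑ η, F η ≤ l * (2 ^ Fintype.card R * (3 / 2 * σ * Real.sqrt H)) := by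
    refine hfin.trans (le_of_eq ?_)
    rw [hl]; nth_rewrite 1 [hHs]; field_simp
  exact le_of_mul_le_mul_left this hlpos

lemma hoeff_step {α : Type*} [Fintype α] (w a : α → ℝ) (B l : ℝ) (hB : 0 < B)
    (hw : ∀ i, 0 ≤ w i) (hw1 : ∑ i, w i = 1) (ha : ∀ i, |a i| ≤ B) (hm : ∑ i, w i * a i = 0) :
    ∑ i, w i * Real.exp (l * a i) ≤ Real.exp (l ^ 2 * B ^ 2 / 2) := by
  have key : ∀ i, Real.exp (l * a i) ≤
      Real.cosh (l * B) + a i / B * Real.sinh (l * B) := by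
    intro i
    have p1 : 0 ≤ (1 + a i / B) / 2 := by
      have := (abs_le.mp (ha i)).1
      have : -1 ≤ a i / B := by rw [le_div_iff₀ hB]; linarith
      linarith
    have p2 : 0 ≤ (1 - a i / B) / 2 := by
      have := (abs_le.mp (ha i)).2
      have : a i / B ≤ 1 := by rw [div_le_iff₀ hB]; linarith
      linarith
    have hc := convexOn_exp.2 (Set.mem_univ (l * B)) (Set.mem_univ (-(l * B))) p1 p2 (by ring)
    simp only [smul_eq_mul] at hc
    have e : (1 + a i / B) / 2 * (l * B) + (1 - a i / B) / 2 * -(l * B) = l * a i := by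
      field_simp; ring
    rw [e] at hc
    refine hc.trans (le_of_eq ?_)
    rw [Real.cosh_eq, Real.sinh_eq]; ring
  calc ∑ i, w i * Real.exp (l * a i)
      ≤ ∑ i, w i * (Real.cosh (l * B) + a i / B * Real.sinh (l * B)) :=
        Finset.sum_le_sum fun i _ => mul_le_mul_of_nonneg_left (key i) (hw i)
    _ = (∑ i, w i) * Real.cosh (l * B) + (∑ i, w i * a i) * (Real.sinh (l * B) / B) := by
        rw [Finset.sum_mul, Finset.sum_mul, ← Finset.sum_add_distrib]
        exact Finset.sum_congr rfl fun i _ => by ring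
    _ ≤ _ := by
        rw [hw1, hm]
        have := Real.cosh_le_exp_half_sq (l * B)
        rw [mul_pow] at this
        linarith

lemma maurey_step {ι Ω : Type*} [Fintype ι] [Fintype Ω] (v : Ω → ι → ℝ) (x : ι → ℝ)
    (K R l : ℝ) (hK : 0 < K) (hR : 0 < R) (hv : ∀ ω i, |v ω i| ≤ K) (hx : ∑ i, |x i| ≤ R)
    [Nonempty ι] (z : Ω → ℝ) :
    ∃ a : ι × Bool, ∑ ω, Real.cosh (l * (z ω + (∑ i, v ω i * x i - R * bsgn a.2 * v ω a.1)))
      ≤ Real.exp (l ^ 2 * (2 * R * K) ^ 2 / 2) * ∑ ω, Real.cosh (l * z ω) := by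
  classical
  set N : ℝ := (Fintype.card ι : ℝ) with hN
  have hNpos : 0 < N := by rw [hN]; exact_mod_cast Fintype.card_pos
  set β : ι → ℝ := fun i => |x i| / R + (1 - (∑ i, |x i|) / R) / N with hβ
  have hβsum : ∑ i, β i = 1 := by
    simp only [hβ]
    rw [Finset.sum_add_distrib, ← Finset.sum_div]
    simp only [Finset.sum_const, Finset.card_univ, nsmul_eq_mul]
    rw [← hN]; field_simp; ring
  have hβx : ∀ i, |x i| / R ≤ β i := by
    intro i
    have : 0 ≤ (1 - (∑ i, |x i|) / R) / N := by
      apply div_nonneg _ hNpos.le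
      have : (∑ i, |x i|) / R ≤ 1 := by rw [div_le_one hR]; exact hx
      linarith
    simp only [hβ]; linarith
  set w : ι × Bool → ℝ := fun a => (β a.1 + bsgn a.2 * (x a.1 / R)) / 2 with hw
  have hw0 : ∀ a, 0 ≤ w a := by
    rintro ⟨i, b⟩
    have h1 := hβx i
    rw [← abs_of_pos hR, ← abs_div] at h1
    have h2 := abs_le.mp h1
    cases b <;> simp [hw, bsgn] <;> linarith [h2.1, h2.2]
  have hw1 : ∑ a, w a = 1 := by
    rw [Fintype.sum_prod_type, ← hβsum]
    refine Finset.sum_congr rfl fun i _ => ?_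
    simp [hw, bsgn]; ring
  have hmean : ∀ ω, ∑ a, w a * (∑ i, v ω i * x i - R * bsgn a.2 * v ω a.1) = 0 := by
    intro ω
    simp only [mul_sub]
    rw [Finset.sum_sub_distrib, ← Finset.sum_mul, hw1, one_mul, Fintype.sum_prod_type, sub_eq_zero]
    refine Finset.sum_congr rfl fun i _ => ?_
    simp [hw, bsgn]; field_simp; ring
  have hbd : ∀ ω a, |∑ i, v ω i * x i - R * bsgn (a : ι × Bool).2 * v ω a.1| ≤ 2 * R * K := by
    intro ω a
    have h1 : |∑ i, v ω i * x i| ≤ R * K := by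
      calc |∑ i, v ω i * x i| ≤ ∑ i, |v ω i * x i| := Finset.abs_sum_le_sum_abs _ _
        _ ≤ ∑ i, K * |x i| := by
          refine Finset.sum_le_sum fun i _ => ?_
          rw [abs_mul]; exact mul_le_mul_of_nonneg_right (hv ω i) (abs_nonneg _)
        _ = K * ∑ i, |x i| := by rw [Finset.mul_sum]
        _ ≤ K * R := by gcongr
        _ = R * K := by ring
    have h2 : |R * bsgn a.2 * v ω a.1| ≤ R * K := by
      have hb : |bsgn a.2| = 1 := by cases a.2 <;> simp [bsgn]
      rw [abs_mul, abs_mul, hb, abs_of_pos hR, mul_one]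
      exact mul_le_mul_of_nonneg_left (hv _ _) hR.le
    calc _ ≤ |∑ i, v ω i * x i| + |R * bsgn a.2 * v ω a.1| := abs_sub _ _
      _ ≤ _ := by linarith
  have hB : 0 < 2 * R * K := by positivity
  have havg : ∑ a, w a * ∑ ω, Real.cosh (l * (z ω + (∑ i, v ω i * x i - R * bsgn a.2 * v ω a.1)))
      ≤ Real.exp (l ^ 2 * (2 * R * K) ^ 2 / 2) * ∑ ω, Real.cosh (l * z ω) := by
    simp only [Finset.mul_sum]
    rw [Finset.sum_comm]
    refine Finset.sum_le_sum fun ω _ => ?_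
    have h1 := hoeff_step w (fun a => ∑ i, v ω i * x i - R * bsgn a.2 * v ω a.1) _ l hB hw0 hw1
      (hbd ω) (hmean ω)
    have h2 := hoeff_step w (fun a => ∑ i, v ω i * x i - R * bsgn a.2 * v ω a.1) _ (-l) hB hw0 hw1
      (hbd ω) (hmean ω)
    rw [neg_sq] at h2
    have e : ∑ a, w a * Real.cosh (l * (z ω + (∑ i, v ω i * x i - R * bsgn a.2 * v ω a.1)))
        = Real.exp (l * z ω) / 2 *
            ∑ a, w a * Real.exp (l * (∑ i, v ω i * x i - R * bsgn a.2 * v ω a.1))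
          + Real.exp (-(l * z ω)) / 2 *
            ∑ a, w a * Real.exp (-l * (∑ i, v ω i * x i - R * bsgn a.2 * v ω a.1)) := by
      rw [Finset.mul_sum, Finset.mul_sum, ← Finset.sum_add_distrib]
      refine Finset.sum_congr rfl fun a _ => ?_
      rw [Real.cosh_eq, mul_add, neg_add, Real.exp_add, Real.exp_add, neg_mul]
      ring
    rw [e, Real.cosh_eq]
    have h1' := mul_le_mul_of_nonneg_left h1 (by positivity : 0 ≤ Real.exp (l * z ω) / 2)
    have h2' := mul_le_mul_of_nonneg_left h2 (by positivity : 0 ≤ Real.exp (-(l * z ω)) / 2)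
    linarith
  by_contra hcon
  push Not at hcon
  obtain ⟨a0, ha0⟩ : ∃ a, 0 < w a := by
    by_contra h
    push Not at h
    have : ∑ a, w a ≤ 0 := Finset.sum_nonpos fun a _ => h a
    linarith
  have : ∑ a, w a * (Real.exp (l ^ 2 * (2 * R * K) ^ 2 / 2) * ∑ ω, Real.cosh (l * z ω)) <
      ∑ a, w a * ∑ ω, Real.cosh (l * (z ω + (∑ i, v ω i * x i - R * bsgn a.2 * v ω a.1))) := by
    refine Finset.sum_lt_sum (fun a _ => mul_le_mul_of_nonneg_left (hcon a).le (hw0 a)) ?_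
    exact ⟨a0, Finset.mem_univ _, mul_lt_mul_of_pos_left (hcon a0) ha0⟩
  rw [← Finset.sum_mul, hw1, one_mul] at this
  linarith

lemma maurey_iter {ι Ω : Type*} [Fintype ι] [Fintype Ω] (v : Ω → ι → ℝ) (x : ι → ℝ)
    (K R l : ℝ) (hK : 0 < K) (hR : 0 < R) (hv : ∀ ω i, |v ω i| ≤ K) (hx : ∑ i, |x i| ≤ R)
    [Nonempty ι] (q : ℕ) :
    ∃ w : Fin q → ι × Bool,
      ∑ ω, Real.cosh (l * (∑ t, (∑ i, v ω i * x i - R * bsgn (w t).2 * v ω (w t).1)))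
      ≤ Real.exp (q * (l ^ 2 * (2 * R * K) ^ 2 / 2)) * Fintype.card Ω := by
  induction q with
  | zero => exact ⟨Fin.elim0, by simp⟩
  | succ q ih =>
    obtain ⟨w, hw⟩ := ih
    obtain ⟨a, ha⟩ := maurey_step v x K R l hK hR hv hx
      (fun ω => ∑ t, (∑ i, v ω i * x i - R * bsgn (w t).2 * v ω (w t).1))
    refine ⟨Fin.snoc w a, ?_⟩
    simp only [Fin.sum_univ_castSucc, Fin.snoc_castSucc, Fin.snoc_last]
    refine ha.trans ?_
    calc _ ≤ Real.exp (l ^ 2 * (2 * R * K) ^ 2 / 2) *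
          (Real.exp (q * (l ^ 2 * (2 * R * K) ^ 2 / 2)) * Fintype.card Ω) := by gcongr
      _ = _ := by
        rw [← mul_assoc, ← Real.exp_add]; push_cast; congr 2; ring

lemma maurey {ι Ω : Type*} [Fintype ι] [Fintype Ω] (v : Ω → ι → ℝ) (x : ι → ℝ)
    (K R H : ℝ) (hK : 0 < K) (hR : 0 < R) (hv : ∀ ω i, |v ω i| ≤ K) (hx : ∑ i, |x i| ≤ R)
    [Nonempty ι] (q : ℕ) (hq : 0 < q) (hH : 0 < H) (hΩ : Real.log (2 * Fintype.card Ω) ≤ H) :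
    ∃ w : Fin q → ι × Bool, ∀ ω,
      |∑ i, v ω i * x i - (∑ t, R * bsgn (w t).2 * v ω (w t).1) / q|
        ≤ 3 * R * K * Real.sqrt H / Real.sqrt q := by
  have hq' : (0 : ℝ) < q := by exact_mod_cast hq
  have hsq : 0 < Real.sqrt q := Real.sqrt_pos.mpr hq'
  have hsH : 0 < Real.sqrt H := Real.sqrt_pos.mpr hH
  set l : ℝ := Real.sqrt H / (2 * R * K * Real.sqrt q) with hl
  have hlpos : 0 < l := by positivity
  obtain ⟨w, hw⟩ := maurey_iter v x K R l hK hR hv hx q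
  refine ⟨w, fun ω => ?_⟩
  have hΩpos : (0 : ℝ) < Fintype.card Ω := by exact_mod_cast Fintype.card_pos_iff.mpr ⟨ω⟩
  set F := ∑ t, (∑ i, v ω i * x i - R * bsgn (w t).2 * v ω (w t).1) with hF
  have h1 : Real.cosh (l * F) ≤ Real.exp (q * (l ^ 2 * (2 * R * K) ^ 2 / 2)) * Fintype.card Ω :=
    (Finset.single_le_sum (f := fun ω => Real.cosh (l * (∑ t, (∑ i, v ω i * x i -
      R * bsgn (w t).2 * v ω (w t).1)))) (fun _ _ => (Real.cosh_pos _).le)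
      (Finset.mem_univ ω)).trans hw
  have h2 : Real.exp |l * F| ≤ 2 * Real.cosh (l * F) := by
    rw [← Real.cosh_abs, Real.cosh_eq]
    linarith [Real.exp_pos (-|l * F|)]
  have e : (q : ℝ) * (l ^ 2 * (2 * R * K) ^ 2 / 2) = H / 2 := by
    rw [hl, div_pow, mul_pow, Real.sq_sqrt hH.le, Real.sq_sqrt hq'.le]; field_simp
  rw [e] at h1
  have h3 : |l * F| ≤ 3 / 2 * H := by
    have : Real.exp |l * F| ≤ Real.exp (H / 2) * (2 * Fintype.card Ω) := by linarith
    have := Real.log_le_log (Real.exp_pos _) this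
    rw [Real.log_exp, Real.log_mul (by positivity) (by positivity), Real.log_exp] at this
    linarith
  rw [abs_mul, abs_of_pos hlpos] at h3
  have e2 : ∑ i, v ω i * x i - (∑ t, R * bsgn (w t).2 * v ω (w t).1) / q = F / q := by
    rw [hF, Finset.sum_sub_distrib]; simp; field_simp
  rw [e2, abs_div, abs_of_pos hq', div_le_div_iff₀ hq' hsq]
  have hHs : H = Real.sqrt H * Real.sqrt H := (Real.mul_self_sqrt hH.le).symm
  have hqs : (q : ℝ) = Real.sqrt q * Real.sqrt q := (Real.mul_self_sqrt hq'.le).symm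
  have h4 : |F| ≤ 3 * R * K * Real.sqrt H * Real.sqrt q := by
    have : l * |F| ≤ l * (3 * R * K * Real.sqrt H * Real.sqrt q) := by
      refine h3.trans (le_of_eq ?_)
      rw [hl]; nth_rewrite 1 [hHs]; field_simp
    exact le_of_mul_le_mul_left this hlpos
  calc |F| * Real.sqrt q ≤ 3 * R * K * Real.sqrt H * Real.sqrt q * Real.sqrt q := by gcongr
    _ = _ := by rw [mul_assoc, ← hqs]

/-- Image of an approximation map coming from the Maurey lemma. -/
lemma maurey_proj {ι Ω : Type*} [Fintype ι] [Fintype Ω] [DecidableEq ι] (v : Ω → ι → ℝ)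
    (T : Finset (ι → ℝ))
    (K R H : ℝ) (hK : 0 < K) (hR : 0 < R) (hv : ∀ ω i, |v ω i| ≤ K)
    (hT : ∀ x ∈ T, ∑ i, |x i| ≤ R)
    [Nonempty ι] (q : ℕ) (hq : 0 < q) (hH : 0 < H) (hΩ : Real.log (2 * Fintype.card Ω) ≤ H) :
    ∃ π : (ι → ℝ) → (ι → ℝ), (∀ x ∈ T, π x ∈ T) ∧
      (T.image π).card ≤ (2 * Fintype.card ι) ^ q ∧
      ∀ x ∈ T, ∀ ω, |∑ i, v ω i * x i - ∑ i, v ω i * π x i|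
        ≤ 6 * R * K * Real.sqrt H / Real.sqrt q := by
  classical
  have hex : ∀ x, ∃ w : Fin q → ι × Bool, x ∈ T → ∀ ω,
      |∑ i, v ω i * x i - (∑ t, R * bsgn (w t).2 * v ω (w t).1) / q|
        ≤ 3 * R * K * Real.sqrt H / Real.sqrt q := by
    intro x
    by_cases hx : x ∈ T
    · obtain ⟨w, hw⟩ := maurey v x K R H hK hR hv (hT x hx) q hq hH hΩ
      exact ⟨w, fun _ => hw⟩
    · exact ⟨fun _ => (Classical.arbitrary ι, true), fun h => absurd h hx⟩
  choose w hw using hex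
  have hsec : ∀ c : Fin q → ι × Bool, ∃ y : ι → ℝ, (∃ x ∈ T, w x = c) → y ∈ T ∧ w y = c := by
    intro c
    by_cases h : ∃ x ∈ T, w x = c
    · obtain ⟨x, hx, hc⟩ := h
      exact ⟨x, fun _ => ⟨hx, hc⟩⟩
    · exact ⟨0, fun h' => absurd h' h⟩
  choose g hg using hsec
  refine ⟨fun x => g (w x), fun x hx => (hg _ ⟨x, hx, rfl⟩).1, ?_, ?_⟩
  · calc (T.image fun x => g (w x)).card ≤ (Finset.univ.image g).card := by
          apply Finset.card_le_card
          intro y hy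
          obtain ⟨x, _, rfl⟩ := Finset.mem_image.mp hy
          exact Finset.mem_image_of_mem _ (Finset.mem_univ _)
      _ ≤ Fintype.card (Fin q → ι × Bool) := Finset.card_image_le
      _ = _ := by simp [mul_comm]
  · intro x hx ω
    have h1 := hw x hx ω
    obtain ⟨h2, h3⟩ := hg (w x) ⟨x, hx, rfl⟩
    have h4 := hw _ h2 ω
    rw [h3] at h4
    rw [abs_sub_comm] at h4
    have := (abs_sub_le _ _ _).trans (add_le_add h1 h4)
    refine this.trans (le_of_eq ?_); ring

lemma chain_levels {ι Ω : Type*} [Fintype ι] [Fintype Ω] [DecidableEq ι] (v : Ω → ι → ℝ)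
    (T : Finset (ι → ℝ)) (s L : ℕ) (hL : 1 ≤ L) (hs : s ≤ 4 ^ L)
    (K R H : ℝ) (hK : 0 < K) (hR : 0 < R) (hv : ∀ ω i, |v ω i| ≤ K)
    (hT : ∀ x ∈ T, ∑ i, |x i| ≤ R) (h0 : (0 : ι → ℝ) ∈ T)
    (hN : 2 ≤ Fintype.card ι) (hH : 1 ≤ H) (hΩ : Real.log (2 * Fintype.card Ω) ≤ H)
    (hTc : Real.log T.card ≤ 6 * s * Real.log (Fintype.card ι)) :
    ∃ π : ℕ → (ι → ℝ) → (ι → ℝ), (∀ x, π 0 x = 0) ∧ (∀ x, π L x = x) ∧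
      ∀ j ≤ L, (∀ x ∈ T, π j x ∈ T) ∧
      Real.log (T.image (π j)).card ≤ 6 * 4 ^ j * Real.log (Fintype.card ι) ∧
      ∀ x ∈ T, ∀ ω, |∑ i, v ω i * x i - ∑ i, v ω i * π j x i|
        ≤ 6 * R * K * Real.sqrt H / 2 ^ j := by
  classical
  have : Nonempty ι := Fintype.card_pos_iff.mp (by omega)
  have hNR : (2 : ℝ) ≤ Fintype.card ι := by exact_mod_cast hN
  have hlogN : 0 ≤ Real.log (Fintype.card ι) := Real.log_nonneg (by linarith)
  have hsH : 1 ≤ Real.sqrt H := Real.one_le_sqrt.mpr hH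
  have hex : ∀ j : ℕ, _ := fun j => maurey_proj v T K R H hK hR hv hT (4 ^ j) (by positivity)
    (by linarith) hΩ
  choose π h1 h2 h3 using hex
  refine ⟨fun j => if j = 0 then fun _ => 0 else if j = L then id else π j, by simp,
    by intro x; simp [show L ≠ 0 by omega], ?_⟩
  intro j hj
  by_cases hj0 : j = 0
  · subst hj0
    simp only [if_true]
    refine ⟨fun _ _ => h0, ?_, ?_⟩
    · have : (T.image fun _ => (0 : ι → ℝ)) = {0} := by
        rw [Finset.image_const ⟨0, h0⟩]
      rw [this]; simp
      positivity
    · intro x hx ω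
      simp only [Pi.zero_apply, mul_zero, Finset.sum_const_zero, sub_zero, pow_zero, div_one]
      calc |∑ i, v ω i * x i| ≤ ∑ i, |v ω i * x i| := Finset.abs_sum_le_sum_abs _ _
        _ ≤ ∑ i, K * |x i| := by
          refine Finset.sum_le_sum fun i _ => ?_
          rw [abs_mul]; exact mul_le_mul_of_nonneg_right (hv ω i) (abs_nonneg _)
        _ = K * ∑ i, |x i| := by rw [Finset.mul_sum]
        _ ≤ K * R := by gcongr; exact hT x hx
        _ ≤ 6 * R * K * 1 := by nlinarith [mul_pos hK hR]
        _ ≤ _ := by gcongr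
  · by_cases hjL : j = L
    · subst hjL
      simp only [if_neg hj0, if_true]
      refine ⟨fun x hx => hx, ?_, ?_⟩
      · rw [Finset.image_id]
        refine hTc.trans ?_
        have : (s : ℝ) ≤ 4 ^ j := by exact_mod_cast hs
        gcongr
      · intro x hx ω
        simp
        positivity
    · simp only [if_neg hj0, if_neg hjL]
      refine ⟨h1 j, ?_, ?_⟩
      · have hc : (0 : ℝ) < (T.image (π j)).card := by
          exact_mod_cast Finset.card_pos.mpr ⟨_, Finset.mem_image_of_mem _ h0⟩
        have h4 : ((T.image (π j)).card : ℝ) ≤ (2 * Fintype.card ι) ^ (4 ^ j) := by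
          exact_mod_cast h2 j
        have h5 := Real.log_le_log hc h4
        rw [Real.log_pow, Real.log_mul (by norm_num) (by linarith)] at h5
        push_cast at h5
        have h6 : Real.log 2 ≤ Real.log (Fintype.card ι) := Real.log_le_log (by norm_num) hNR
        have h7 : (0:ℝ) < 4 ^ j := by positivity
        refine h5.trans ?_
        calc (4:ℝ) ^ j * (Real.log 2 + Real.log (Fintype.card ι))
            ≤ 4 ^ j * (6 * Real.log (Fintype.card ι)) := by gcongr; linarith
          _ = _ := by ring
      · intro x hx ω
        have := h3 j x hx ω
        have e : Real.sqrt ((4 ^ j : ℕ) : ℝ) = 2 ^ j := by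
          push_cast
          rw [show (4 : ℝ) = 2 ^ 2 by norm_num, ← pow_mul, mul_comm, pow_mul,
            Real.sqrt_sq (by positivity)]
        rwa [e] at this

lemma fiber_sq {Ω P : Type*} [Fintype Ω] [Fintype P] [DecidableEq P] (rep : Ω → P)
    (hrep : ∀ r, (Finset.univ.filter fun ω => rep ω = r).card ≤ 2) (t : Ω → ℝ) :
    ∑ r, (∑ ω with rep ω = r, t ω) ^ 2 ≤ 2 * ∑ ω, t ω ^ 2 := by
  rw [← Finset.sum_fiberwise (s := Finset.univ) (g := rep) (f := fun ω => t ω ^ 2), Finset.mul_sum]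
  refine Finset.sum_le_sum fun r _ => ?_
  refine sq_sum_le_card_mul_sum_sq.trans ?_
  gcongr
  exact_mod_cast hrep r

lemma fiber_rad {Ω P : Type*} [Fintype Ω] [Fintype P] [DecidableEq P] (rep : Ω → P)
    (η : P → Bool) (t : Ω → ℝ) :
    ∑ ω, bsgn (η (rep ω)) * t ω = ∑ r, bsgn (η r) * ∑ ω with rep ω = r, t ω := by
  rw [← Finset.sum_fiberwise (s := Finset.univ) (g := rep)]
  refine Finset.sum_congr rfl fun r _ => ?_
  rw [Finset.mul_sum]
  refine Finset.sum_congr rfl fun ω hω => ?_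
  rw [(Finset.mem_filter.mp hω).2]

lemma chaining {ι Ω P : Type*} [Fintype ι] [Fintype Ω] [DecidableEq ι] [Fintype P] [DecidableEq P]
    (rep : Ω → P) (hrep : ∀ r, (Finset.univ.filter fun ω => rep ω = r).card ≤ 2)
    (v : Ω → ι → ℝ)
    (T : Finset (ι → ℝ)) (s L : ℕ) (hL : 1 ≤ L) (hs : s ≤ 4 ^ L)
    (K R H D : ℝ) (hK : 0 < K) (hR : 0 < R) (hv : ∀ ω i, |v ω i| ≤ K)
    (hT : ∀ x ∈ T, ∑ i, |x i| ≤ R) (h0 : (0 : ι → ℝ) ∈ T)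
    (hN : 2 ≤ Fintype.card ι) (hH : 1 ≤ H) (hΩ : Real.log (2 * Fintype.card Ω) ≤ H)
    (hTc : Real.log T.card ≤ 6 * s * Real.log (Fintype.card ι))
    (hD : 0 < D) (hTD : ∀ x ∈ T, ∑ ω, (∑ i, v ω i * x i) ^ 2 ≤ D ^ 2)
    (F : (P → Bool) → ℝ)
    (hF : ∀ η, ∃ x ∈ T, F η ≤ |∑ ω, bsgn (η (rep ω)) * (∑ i, v ω i * x i) ^ 2|) :
    ∑ η, F η ≤ 2 ^ Fintype.card P *
      (324 * L * (R * K * Real.sqrt H * D * Real.sqrt (Real.log (Fintype.card ι)))) := by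
  classical
  obtain ⟨π, hπ0, hπL, hπ⟩ := chain_levels v T s L hL hs K R H hK hR hv hT h0 hN hH hΩ hTc
  have hNR : (2 : ℝ) ≤ Fintype.card ι := by exact_mod_cast hN
  have hlog2 : Real.log 2 ≤ Real.log (Fintype.card ι) := Real.log_le_log (by norm_num) hNR
  have hlogN : 0 < Real.log (Fintype.card ι) := Real.log_pos (by linarith)
  have hsH : 1 ≤ Real.sqrt H := Real.one_le_sqrt.mpr hH
  set f : Ω → (ι → ℝ) → ℝ := fun ω x => ∑ i, v ω i * x i with hf
  set Q : (P → Bool) → (ι → ℝ) → ℝ := fun η x => ∑ ω, bsgn (η (rep ω)) * (f ω x) ^ 2 with hQ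
  have hne : T.Nonempty := ⟨0, h0⟩
  set S : ℕ → (P → Bool) → ℝ := fun j η =>
    T.sup' hne fun x => |Q η (π (j + 1) x) - Q η (π j x)| with hS
  set ρ : ℝ := 6 * R * K * Real.sqrt H with hρ
  have hρpos : 0 < ρ := by positivity
  have hFS : ∀ η, F η ≤ ∑ j ∈ Finset.range L, S j η := by
    intro η
    obtain ⟨x, hx, h⟩ := hF η
    have h1 : Q η x = ∑ j ∈ Finset.range L, (Q η (π (j + 1) x) - Q η (π j x)) := by
      rw [Finset.sum_range_sub (fun j => Q η (π j x)), hπ0, hπL]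
      simp [hQ, hf]
    calc F η ≤ |Q η x| := h
      _ ≤ ∑ j ∈ Finset.range L, |Q η (π (j + 1) x) - Q η (π j x)| := by
        rw [h1]; exact Finset.abs_sum_le_sum_abs _ _
      _ ≤ _ := by
        refine Finset.sum_le_sum fun j _ => ?_
        exact Finset.le_sup' (fun x => |Q η (π (j + 1) x) - Q η (π j x)|) hx
  have hlink : ∀ j ∈ Finset.range L, ∑ η, S j η ≤ 2 ^ Fintype.card P *
      (54 * (ρ * D * Real.sqrt (Real.log (Fintype.card ι)))) := by
    intro j hj
    have hjL : j < L := Finset.mem_range.mp hj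
    obtain ⟨a1, a2, a3⟩ := hπ j hjL.le
    obtain ⟨b1, b2, b3⟩ := hπ (j + 1) hjL
    have h2j : (0:ℝ) < 2 ^ j := by positivity
    have h4j : (1:ℝ) ≤ 4 ^ j := one_le_pow₀ (by norm_num)
    have key := rad_max (R := P) (T.image fun x => (π (j + 1) x, π j x))
      (fun ab r => ∑ ω with rep ω = r, ((f ω ab.1) ^ 2 - (f ω ab.2) ^ 2))
      (6 * ρ * D / 2 ^ j) (31 * 4 ^ j * Real.log (Fintype.card ι)) (by positivity) (by positivity)
      ?_ ?_ (S j) ?_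
    · refine key.trans (mul_le_mul_of_nonneg_left ?_ (by positivity))
      have e : Real.sqrt (31 * 4 ^ j * Real.log (Fintype.card ι)) ≤
          6 * 2 ^ j * Real.sqrt (Real.log (Fintype.card ι)) := by
        apply Real.sqrt_le_iff.mpr
        refine ⟨by positivity, ?_⟩
        rw [mul_pow, mul_pow, Real.sq_sqrt hlogN.le, ← pow_mul, mul_comm j 2, pow_mul]
        norm_num
        nlinarith [mul_pos (by positivity : (0:ℝ) < 4 ^ j) hlogN]
      calc 3 / 2 * (6 * ρ * D / 2 ^ j) * Real.sqrt (31 * 4 ^ j * Real.log (Fintype.card ι))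
          ≤ 3 / 2 * (6 * ρ * D / 2 ^ j) * (6 * 2 ^ j * Real.sqrt (Real.log (Fintype.card ι))) := by
            gcongr
        _ = _ := by field_simp; ring
    · intro ab hab
      obtain ⟨x, hx, rfl⟩ := Finset.mem_image.mp hab
      refine (fiber_sq rep hrep _).trans ?_
      have hd : ∀ ω, |f ω (π (j + 1) x) - f ω (π j x)| ≤ 2 * ρ / 2 ^ j := by
        intro ω
        have c1 := a3 x hx ω
        have c2 := b3 x hx ω
        rw [abs_sub_comm] at c2
        refine ((abs_sub_le _ _ _).trans (add_le_add c2 c1)).trans ?_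
        rw [pow_succ]
        have : ρ / (2 ^ j * 2) = ρ / 2 ^ j / 2 := by rw [div_div]
        rw [this, mul_div_assoc 2 ρ]
        have : 0 < ρ / 2 ^ j := by positivity
        linarith
      have hsum : ∑ ω, (f ω (π (j + 1) x) + f ω (π j x)) ^ 2 ≤ 4 * D ^ 2 := by
        have c1 := hTD _ (a1 x hx)
        have c2 := hTD _ (b1 x hx)
        calc ∑ ω, (f ω (π (j + 1) x) + f ω (π j x)) ^ 2
            ≤ ∑ ω, (2 * (f ω (π (j + 1) x)) ^ 2 + 2 * (f ω (π j x)) ^ 2) := by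
              refine Finset.sum_le_sum fun ω _ => ?_
              nlinarith [sq_nonneg (f ω (π (j + 1) x) - f ω (π j x))]
          _ = 2 * ∑ ω, (f ω (π (j + 1) x)) ^ 2 + 2 * ∑ ω, (f ω (π j x)) ^ 2 := by
              rw [Finset.sum_add_distrib, Finset.mul_sum, Finset.mul_sum]
          _ ≤ _ := by linarith
      calc 2 * ∑ ω, ((f ω (π (j + 1) x)) ^ 2 - (f ω (π j x)) ^ 2) ^ 2
          ≤ 2 * ∑ ω, (2 * ρ / 2 ^ j) ^ 2 * (f ω (π (j + 1) x) + f ω (π j x)) ^ 2 := by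
            gcongr with ω
            have : ((f ω (π (j + 1) x)) ^ 2 - (f ω (π j x)) ^ 2) ^ 2 =
              (f ω (π (j + 1) x) - f ω (π j x)) ^ 2 * (f ω (π (j + 1) x) + f ω (π j x)) ^ 2 := by
              ring
            rw [this]
            gcongr ?_ * _
            exact sq_le_sq' (by linarith [(abs_le.mp (hd ω)).1]) (abs_le.mp (hd ω)).2
        _ = 2 * (2 * ρ / 2 ^ j) ^ 2 * ∑ ω, (f ω (π (j + 1) x) + f ω (π j x)) ^ 2 := by
            rw [← Finset.mul_sum]; ring
        _ ≤ 2 * (2 * ρ / 2 ^ j) ^ 2 * (4 * D ^ 2) := by gcongr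
        _ = 32 * (ρ * D / 2 ^ j) ^ 2 := by ring
        _ ≤ 36 * (ρ * D / 2 ^ j) ^ 2 := by gcongr; norm_num
        _ = _ := by ring
    · have hc : ((T.image fun x => (π (j + 1) x, π j x)).card : ℝ) ≤
          (T.image (π (j + 1))).card * (T.image (π j)).card := by
        rw [← Nat.cast_mul, ← Finset.card_product]
        norm_cast
        apply Finset.card_le_card
        intro y hy
        obtain ⟨x, hx, rfl⟩ := Finset.mem_image.mp hy
        exact Finset.mem_product.mpr ⟨Finset.mem_image_of_mem _ hx, Finset.mem_image_of_mem _ hx⟩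
      have p1 : (0:ℝ) < (T.image fun x => (π (j + 1) x, π j x)).card := by
        exact_mod_cast Finset.card_pos.mpr ⟨_, Finset.mem_image_of_mem _ h0⟩
      have p2 : (0:ℝ) < (T.image (π (j + 1))).card := by
        exact_mod_cast Finset.card_pos.mpr ⟨_, Finset.mem_image_of_mem _ h0⟩
      have p3 : (0:ℝ) < (T.image (π j)).card := by
        exact_mod_cast Finset.card_pos.mpr ⟨_, Finset.mem_image_of_mem _ h0⟩
      have h5 := Real.log_le_log p1 hc
      rw [Real.log_mul p2.ne' p3.ne'] at h5
      rw [Real.log_mul (by norm_num) p1.ne']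
      rw [pow_succ] at b2
      nlinarith [mul_le_mul_of_nonneg_right h4j hlogN.le]
    · intro η
      obtain ⟨x, hx, h⟩ := Finset.exists_mem_eq_sup' hne
        (fun x => |Q η (π (j + 1) x) - Q η (π j x)|)
      refine ⟨(π (j + 1) x, π j x), Finset.mem_image_of_mem _ hx, ?_⟩
      simp only [hS]
      rw [h, ← fiber_rad]
      apply le_of_eq
      congr 1
      simp only [hQ]
      rw [← Finset.sum_sub_distrib]
      exact Finset.sum_congr rfl fun ω _ => by ring
  calc ∑ η, F η ≤ ∑ η, ∑ j ∈ Finset.range L, S j η := Finset.sum_le_sum fun η _ => hFS η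
    _ = ∑ j ∈ Finset.range L, ∑ η, S j η := Finset.sum_comm
    _ ≤ ∑ j ∈ Finset.range L, 2 ^ Fintype.card P *
      (54 * (ρ * D * Real.sqrt (Real.log (Fintype.card ι)))) := Finset.sum_le_sum hlink
    _ = _ := by
      rw [Finset.sum_const, Finset.card_range, nsmul_eq_mul, hρ]; ring

/-- Grid of mesh `1/(4 * s)` in `[-1,1]`. -/
noncomputable def sgrid (s : ℕ) : Finset ℝ :=
  (Finset.Icc (-(4 * s : ℤ)) (4 * s)).image fun k : ℤ => (k : ℝ) / (4 * s)

/-- Finite net of sparse vectors with grid entries in the unit ball. -/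
noncomputable def snet (ι : Type*) [Fintype ι] [DecidableEq ι] (s : ℕ) : Finset (ι → ℝ) :=
  ((Finset.powersetCard s (Finset.univ : Finset ι)).biUnion fun Γ =>
    Fintype.piFinset fun i => if i ∈ Γ then sgrid s else {0}).filter fun x => ∑ i, x i ^ 2 ≤ 1

lemma sgrid_card (s : ℕ) : (sgrid s).card ≤ 8 * s + 1 := by
  refine Finset.card_image_le.trans ?_
  simp; omega

lemma zero_mem_sgrid (s : ℕ) : (0 : ℝ) ∈ sgrid s := by
  refine Finset.mem_image.mpr ⟨0, ?_, by simp⟩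
  simp

section net
variable {ι : Type*} [Fintype ι] [DecidableEq ι] {s : ℕ}

lemma mem_snet {x : ι → ℝ} : x ∈ snet ι s ↔
    (∃ Γ : Finset ι, Γ.card = s ∧ ∀ i, x i ∈ (if i ∈ Γ then sgrid s else {0})) ∧
      ∑ i, x i ^ 2 ≤ 1 := by
  simp only [snet, Finset.mem_filter, Finset.mem_biUnion, Finset.mem_powersetCard,
    Finset.subset_univ, true_and, Fintype.mem_piFinset]

lemma zero_mem_snet (hs : s ≤ Fintype.card ι) : (0 : ι → ℝ) ∈ snet ι s := by
  obtain ⟨Γ, _, hΓ⟩ := Finset.exists_subset_card_eq (s := (Finset.univ : Finset ι)) (n := s)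
    (by simpa using hs)
  refine mem_snet.mpr ⟨⟨Γ, hΓ, fun i => ?_⟩, by simp⟩
  split_ifs
  · exact zero_mem_sgrid s
  · simp

lemma snet_l2 {x : ι → ℝ} (hx : x ∈ snet ι s) : ∑ i, x i ^ 2 ≤ 1 := (mem_snet.mp hx).2

lemma snet_l1 {x : ι → ℝ} (hx : x ∈ snet ι s) : ∑ i, |x i| ≤ Real.sqrt s := by
  obtain ⟨⟨Γ, hΓ, h⟩, h2⟩ := mem_snet.mp hx
  have h0 : ∀ i, i ∉ Γ → x i = 0 := by
    intro i hi
    have := h i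
    simpa [hi] using this
  have e : ∑ i, |x i| = ∑ i ∈ Γ, |x i| := by
    symm
    apply Finset.sum_subset (Finset.subset_univ _)
    intro i _ hi
    simp [h0 i hi]
  rw [e]
  apply Real.le_sqrt_of_sq_le
  refine sq_sum_le_card_mul_sum_sq.trans ?_
  rw [hΓ]
  have : ∑ i ∈ Γ, |x i| ^ 2 ≤ 1 := by
    refine le_trans ?_ h2
    simp only [sq_abs]
    exact Finset.sum_le_sum_of_subset_of_nonneg (Finset.subset_univ _) fun i _ _ => sq_nonneg _
  have hs0 : (0 : ℝ) ≤ s := by positivity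
  nlinarith

lemma snet_card (hs1 : s ≤ Fintype.card ι) (hN : 2 ≤ Fintype.card ι) :
    Real.log (snet ι s).card ≤ 6 * s * Real.log (Fintype.card ι) := by
  have h1 : (snet ι s).card ≤ (Fintype.card ι) ^ s * (8 * s + 1) ^ s := by
    refine (Finset.card_filter_le _ _).trans ?_
    refine Finset.card_biUnion_le.trans ?_
    calc _ ≤ ∑ Γ ∈ Finset.powersetCard s (Finset.univ : Finset ι), (8 * s + 1) ^ s := by
          refine Finset.sum_le_sum fun Γ hΓ => ?_
          have hΓ' := (Finset.mem_powersetCard.mp hΓ).2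
          rw [Fintype.card_piFinset]
          have : ∀ i, (if i ∈ Γ then sgrid s else {0} : Finset ℝ).card
              = if i ∈ Γ then (sgrid s).card else 1 := by
            intro i; split_ifs <;> simp
          simp only [this]
          rw [Finset.prod_ite_mem, Finset.univ_inter, Finset.prod_const, hΓ']
          exact Nat.pow_le_pow_left (sgrid_card s) s
      _ ≤ _ := by
          rw [Finset.sum_const, Finset.card_powersetCard, smul_eq_mul, Finset.card_univ]
          exact Nat.mul_le_mul_right _ (Nat.choose_le_pow _ _)
  set N := Fintype.card ι with hNdef
  have h2 : (snet ι s).card ≤ N ^ (6 * s) := by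
    refine h1.trans ?_
    rw [show 6 * s = s + 5 * s by ring, pow_add, pow_mul]
    refine Nat.mul_le_mul_left _ (Nat.pow_le_pow_left ?_ s)
    have : 2 ^ 4 ≤ N ^ 4 := Nat.pow_le_pow_left hN 4
    calc 8 * s + 1 ≤ 2 ^ 4 * N := by omega
      _ ≤ N ^ 4 * N := Nat.mul_le_mul_right _ this
      _ = N ^ 5 := by ring
  have hpos : 0 < (snet ι s).card := Finset.card_pos.mpr ⟨0, zero_mem_snet hs1⟩
  have h3 : ((snet ι s).card : ℝ) ≤ (N : ℝ) ^ (6 * s) := by exact_mod_cast h2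
  have := Real.log_le_log (by exact_mod_cast hpos) h3
  rw [Real.log_pow] at this
  push_cast at this
  exact this

/-- Truncation towards zero. -/
noncomputable def truncZ (t : ℝ) : ℤ := if 0 ≤ t then ⌊t⌋ else ⌈t⌉

lemma truncZ_abs (t : ℝ) : |(truncZ t : ℝ)| ≤ |t| := by
  unfold truncZ
  split_ifs with h
  · have h1 : (0 : ℝ) ≤ ⌊t⌋ := by exact_mod_cast Int.floor_nonneg.mpr h
    rw [abs_of_nonneg h1, abs_of_nonneg h]; exact Int.floor_le t
  · push Not at h
    have h1 : (⌈t⌉ : ℝ) ≤ 0 := by exact_mod_cast Int.ceil_le.mpr (by simpa using h.le)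
    rw [abs_of_nonpos h1, abs_of_neg h]; linarith [Int.le_ceil t]

lemma truncZ_sub (t : ℝ) : |t - truncZ t| ≤ 1 := by
  unfold truncZ
  rw [abs_le]
  split_ifs with h
  · constructor <;> linarith [Int.floor_le t, Int.lt_floor_add_one t]
  · constructor <;> linarith [Int.le_ceil t, Int.ceil_lt_add_one t]

lemma snet_approx (hs : 1 ≤ s) (Γ : Finset ι) (hΓ : Γ.card = s) (x : ι → ℝ)
    (hx : ∀ i, i ∉ Γ → x i = 0) (hx1 : ∑ i, x i ^ 2 ≤ 1) :
    ∃ y ∈ snet ι s, (∀ i, i ∉ Γ → y i = 0) ∧ ∑ i, (4 * (x i - y i)) ^ 2 ≤ 1 := by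
  have hsR : (1 : ℝ) ≤ s := by exact_mod_cast hs
  have h4 : (0 : ℝ) < 4 * s := by linarith
  set y : ι → ℝ := fun i => (truncZ (4 * s * x i) : ℝ) / (4 * s) with hy
  have hyx : ∀ i, |y i| ≤ |x i| := by
    intro i
    simp only [hy]
    rw [abs_div, abs_of_pos h4, div_le_iff₀ h4]
    refine (truncZ_abs _).trans ?_
    rw [abs_mul, abs_of_pos h4]; linarith
  have hy0 : ∀ i, i ∉ Γ → y i = 0 := by
    intro i hi
    have := hyx i
    rw [hx i hi, abs_zero] at this
    exact abs_eq_zero.mp (le_antisymm this (abs_nonneg _))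
  have hx1' : ∀ i, |x i| ≤ 1 := by
    intro i
    have h1 : x i ^ 2 ≤ 1 :=
      (Finset.single_le_sum (f := fun i => x i ^ 2) (fun i _ => sq_nonneg _)
        (Finset.mem_univ i)).trans hx1
    exact (sq_le_one_iff_abs_le_one _).mp h1
  refine ⟨y, mem_snet.mpr ⟨⟨Γ, hΓ, fun i => ?_⟩, ?_⟩, hy0, ?_⟩
  · split_ifs with hi
    · refine Finset.mem_image.mpr ⟨truncZ (4 * s * x i), ?_, rfl⟩
      have h5 := truncZ_abs (4 * s * x i)
      rw [abs_mul, abs_of_pos h4] at h5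
      have h6 : |(truncZ (4 * s * x i) : ℝ)| ≤ 4 * s := by nlinarith [hx1' i]
      have h7 := abs_le.mp h6
      rw [Finset.mem_Icc]
      constructor
      · have := h7.1; exact_mod_cast this
      · have := h7.2; exact_mod_cast this
    · simpa using hy0 i hi
  · refine (Finset.sum_le_sum fun i _ => ?_).trans hx1
    exact sq_le_sq.mpr (hyx i)
  · have e : ∑ i, (4 * (x i - y i)) ^ 2 = ∑ i ∈ Γ, (4 * (x i - y i)) ^ 2 := by
      symm
      apply Finset.sum_subset (Finset.subset_univ _)
      intro i _ hi
      simp [hx i hi, hy0 i hi]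
    rw [e]
    have h5 : ∀ i ∈ Γ, (4 * (x i - y i)) ^ 2 ≤ 1 / s ^ 2 := by
      intro i _
      have h6 : 4 * (x i - y i) = (4 * s * x i - truncZ (4 * s * x i)) / s := by
        simp only [hy]; field_simp
      rw [h6, div_pow]
      gcongr
      exact (sq_le_one_iff_abs_le_one _).mpr (truncZ_sub _)
    refine (Finset.sum_le_sum h5).trans ?_
    rw [Finset.sum_const, hΓ, nsmul_eq_mul, mul_one_div, div_le_one (by positivity)]
    nlinarith

lemma quad_le (A : Matrix ι ι ℝ) (hA : A.IsSymm) (hs : 1 ≤ s) (M : ℝ)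
    (hM : ∀ x ∈ snet ι s, |x ⬝ᵥ A *ᵥ x| ≤ M) (Γ : Finset ι) (hΓ : Γ.card = s) (y z : ι → ℝ)
    (hy : ∀ i, i ∉ Γ → y i = 0) (hz : ∀ i, i ∉ Γ → z i = 0)
    (hy1 : ∑ i, y i ^ 2 ≤ 1) (hz1 : ∑ i, z i ^ 2 ≤ 1) :
    |y ⬝ᵥ A *ᵥ z| ≤ 4 * M := by
  set S : Set ℝ := {r | ∃ x : ι → ℝ, (∀ i, i ∉ Γ → x i = 0) ∧ ∑ i, x i ^ 2 ≤ 1 ∧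
    r = |x ⬝ᵥ A *ᵥ x|} with hS
  have hbdd : BddAbove S := by
    refine ⟨∑ i, ∑ j, |A i j|, ?_⟩
    rintro r ⟨x, _, hx1, rfl⟩
    have hx1' : ∀ i, |x i| ≤ 1 := by
      intro i
      have h1 : x i ^ 2 ≤ 1 :=
        (Finset.single_le_sum (f := fun i => x i ^ 2) (fun i _ => sq_nonneg _)
          (Finset.mem_univ i)).trans hx1
      exact (sq_le_one_iff_abs_le_one _).mp h1
    simp only [dotProduct, mulVec, Finset.mul_sum]
    refine (Finset.abs_sum_le_sum_abs _ _).trans (Finset.sum_le_sum fun i _ => ?_)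
    refine (Finset.abs_sum_le_sum_abs _ _).trans (Finset.sum_le_sum fun j _ => ?_)
    rw [abs_mul, abs_mul]
    have := mul_le_mul (hx1' i) (mul_le_mul_of_nonneg_left (hx1' j) (abs_nonneg (A i j)))
      (by positivity) zero_le_one
    linarith
  set δ := sSup S with hδ
  have hδ0 : 0 ≤ δ := by
    refine (abs_nonneg _).trans (le_csSup hbdd ⟨0, by simp, by simp, rfl⟩)
  have c1 : ∀ x : ι → ℝ, (∀ i, i ∉ Γ → x i = 0) → |x ⬝ᵥ A *ᵥ x| ≤ δ * ∑ i, x i ^ 2 := by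
    intro x hx
    by_cases h0 : ∑ i, x i ^ 2 = 0
    · have : x = 0 := by
        funext i
        have := (Finset.sum_eq_zero_iff_of_nonneg (fun i _ => sq_nonneg (x i))).mp h0 i
          (Finset.mem_univ _)
        simpa using this
      subst this; simp
    · have hpos : 0 < ∑ i, x i ^ 2 := lt_of_le_of_ne (Finset.sum_nonneg fun i _ => sq_nonneg _)
        (Ne.symm h0)
      set t := Real.sqrt (∑ i, x i ^ 2) with ht
      have htpos : 0 < t := Real.sqrt_pos.mpr hpos
      have ht2 : t ^ 2 = ∑ i, x i ^ 2 := Real.sq_sqrt hpos.le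
      have h1 : |(t⁻¹ • x) ⬝ᵥ A *ᵥ (t⁻¹ • x)| ≤ δ := by
        refine le_csSup hbdd ⟨t⁻¹ • x, fun i hi => by simp [hx i hi], ?_, rfl⟩
        simp only [Pi.smul_apply, smul_eq_mul, mul_pow]
        rw [← Finset.mul_sum, ← ht2]
        apply le_of_eq; field_simp
      rw [mulVec_smul, smul_dotProduct, dotProduct_smul, smul_eq_mul, smul_eq_mul, ← mul_assoc,
        abs_mul, abs_of_pos (by positivity : 0 < t⁻¹ * t⁻¹)] at h1
      rw [← ht2]
      have h2 := mul_le_mul_of_nonneg_left h1 (by positivity : 0 ≤ t ^ 2)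
      have h3 : t ^ 2 * (t⁻¹ * t⁻¹ * |x ⬝ᵥ A *ᵥ x|) = |x ⬝ᵥ A *ᵥ x| := by field_simp
      linarith
  have hsymm : ∀ y z : ι → ℝ, y ⬝ᵥ A *ᵥ z = z ⬝ᵥ A *ᵥ y := by
    intro y z
    rw [dotProduct_mulVec, ← mulVec_transpose, hA.eq, dotProduct_comm]
  have c2 : ∀ y z : ι → ℝ, (∀ i, i ∉ Γ → y i = 0) → (∀ i, i ∉ Γ → z i = 0) →
      |y ⬝ᵥ A *ᵥ z| ≤ δ * (∑ i, y i ^ 2 + ∑ i, z i ^ 2) / 2 := by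
    intro y z hy hz
    have h1 := c1 (y + z) (fun i hi => by simp [hy i hi, hz i hi])
    have h2 := c1 (y - z) (fun i hi => by simp [hy i hi, hz i hi])
    have e : 4 * (y ⬝ᵥ A *ᵥ z) = (y + z) ⬝ᵥ A *ᵥ (y + z) - (y - z) ⬝ᵥ A *ᵥ (y - z) := by
      simp only [mulVec_add, mulVec_sub, add_dotProduct, sub_dotProduct, dotProduct_add,
        dotProduct_sub]
      rw [hsymm z y]; ring
    have e2 : ∑ i, (y + z) i ^ 2 + ∑ i, (y - z) i ^ 2 = 2 * (∑ i, y i ^ 2 + ∑ i, z i ^ 2) := by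
      rw [← Finset.sum_add_distrib, ← Finset.sum_add_distrib, Finset.mul_sum]
      refine Finset.sum_congr rfl fun i _ => ?_
      simp only [Pi.add_apply, Pi.sub_apply]; ring
    have h3 : |4 * (y ⬝ᵥ A *ᵥ z)| ≤ δ * (2 * (∑ i, y i ^ 2 + ∑ i, z i ^ 2)) := by
      rw [e, ← e2, mul_add]
      exact (abs_sub _ _).trans (add_le_add h1 h2)
    rw [abs_mul, abs_of_pos (by norm_num : (0:ℝ) < 4)] at h3
    linarith
  have c3 : δ ≤ M + 9 / 16 * δ := by
    refine csSup_le (⟨_, 0, by simp, by simp, rfl⟩ : S.Nonempty) ?_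
    rintro r ⟨x, hx, hx1, rfl⟩
    obtain ⟨u, hu, hu0, hux⟩ := snet_approx hs Γ hΓ x hx hx1
    set w : ι → ℝ := (4 : ℝ) • (x - u) with hw
    have hw0 : ∀ i, i ∉ Γ → w i = 0 := fun i hi => by simp [hw, hx i hi, hu0 i hi]
    have hw1 : ∑ i, w i ^ 2 ≤ 1 := by simpa [hw] using hux
    have hxu : x = u + (1 / 4 : ℝ) • w := by
      rw [hw]; ext i; simp
    have h1 := c2 u w hu0 hw0
    have h2 := c2 w w hw0 hw0
    have h3 := hM u hu
    have hu1 := snet_l2 hu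
    have e : x ⬝ᵥ A *ᵥ x = u ⬝ᵥ A *ᵥ u + 1 / 2 * (u ⬝ᵥ A *ᵥ w) + 1 / 16 * (w ⬝ᵥ A *ᵥ w) := by
      rw [hxu]
      simp only [mulVec_add, mulVec_smul, add_dotProduct, dotProduct_add, smul_dotProduct,
        dotProduct_smul, smul_eq_mul]
      rw [hsymm w u]; ring
    have h1' : |u ⬝ᵥ A *ᵥ w| ≤ δ := by nlinarith
    have h2' : |w ⬝ᵥ A *ᵥ w| ≤ δ := by nlinarith
    rw [e]
    have := abs_le.mp h1'
    have := abs_le.mp h2'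
    have := abs_le.mp h3
    rw [abs_le]
    constructor <;> linarith
  have c4 := c2 y z hy hz
  have c5 : |y ⬝ᵥ A *ᵥ z| ≤ δ := by nlinarith
  have : 0 ≤ M := by nlinarith
  nlinarith

lemma snormS_le (A : Matrix ι ι ℝ) (hA : A.IsSymm) (hs : 1 ≤ s) (hsN : s ≤ Fintype.card ι) (M : ℝ)
    (hM : ∀ x ∈ snet ι s, |x ⬝ᵥ A *ᵥ x| ≤ M) :
    snormS s (A.map Complex.ofReal) ≤ 16 * M := by
  have hM0 : 0 ≤ M := (abs_nonneg _).trans (hM 0 (zero_mem_snet hsN))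
  apply Real.sSup_le _ (by positivity)
  rintro r ⟨Γ, x, y, hΓ, hx, hy, hx1, hy1, rfl⟩
  obtain ⟨Γ', hΓ', hc⟩ := Finset.exists_superset_card_eq hΓ hsN
  have key : ∀ a b : ι → ℝ, (∀ i, i ∉ Γ → a i = 0) → (∀ i, i ∉ Γ → b i = 0) →
      ∑ i, a i ^ 2 ≤ 1 → ∑ i, b i ^ 2 ≤ 1 → |a ⬝ᵥ A *ᵥ b| ≤ 4 * M :=
    fun a b ha hb ha1 hb1 => quad_le A hA hs M hM Γ' hc a b
      (fun i hi => ha i fun h => hi (hΓ' h)) (fun i hi => hb i fun h => hi (hΓ' h)) ha1 hb1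
  have sqr : ∀ u : ι → ℂ, ∑ i, ‖u i‖ ^ 2 = 1 → ∑ i, (u i).re ^ 2 ≤ 1 ∧ ∑ i, (u i).im ^ 2 ≤ 1 := by
    intro u hu
    have : ∀ i, ‖u i‖ ^ 2 = (u i).re ^ 2 + (u i).im ^ 2 := fun i => by
      rw [← Complex.normSq_eq_norm_sq, Complex.normSq_apply]; ring
    constructor
    · rw [← hu]; exact Finset.sum_le_sum fun i _ => by rw [this]; nlinarith [sq_nonneg (u i).im]
    · rw [← hu]; exact Finset.sum_le_sum fun i _ => by rw [this]; nlinarith [sq_nonneg (u i).re]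
  obtain ⟨x1, x2⟩ := sqr x hx1
  obtain ⟨y1, y2⟩ := sqr y hy1
  have xr : ∀ i, i ∉ Γ → (x i).re = 0 := fun i hi => by simp [hx i hi]
  have xi : ∀ i, i ∉ Γ → (x i).im = 0 := fun i hi => by simp [hx i hi]
  have yr : ∀ i, i ∉ Γ → (y i).re = 0 := fun i hi => by simp [hy i hi]
  have yi : ∀ i, i ∉ Γ → (y i).im = 0 := fun i hi => by simp [hy i hi]
  have k1 := abs_le.mp (key _ _ yr xr y1 x1)
  have k2 := abs_le.mp (key _ _ yr xi y1 x2)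
  have k3 := abs_le.mp (key _ _ yi xr y2 x1)
  have k4 := abs_le.mp (key _ _ yi xi y2 x2)
  refine (Complex.norm_le_abs_re_add_abs_im _).trans ?_
  have ere : (star y ⬝ᵥ (A.map Complex.ofReal) *ᵥ x).re =
      (fun i => (y i).re) ⬝ᵥ A *ᵥ (fun i => (x i).re) +
      (fun i => (y i).im) ⬝ᵥ A *ᵥ (fun i => (x i).im) := by
    simp only [dotProduct, mulVec, Complex.re_sum, Pi.star_apply, Complex.mul_re, Complex.im_sum,
      Matrix.map_apply, Complex.mul_im, Complex.ofReal_re, Complex.ofReal_im, RCLike.star_def,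
      Complex.conj_re, Complex.conj_im, zero_mul, sub_zero, add_zero]
    rw [← Finset.sum_add_distrib]
    refine Finset.sum_congr rfl fun i _ => by ring
  have eim : (star y ⬝ᵥ (A.map Complex.ofReal) *ᵥ x).im =
      (fun i => (y i).re) ⬝ᵥ A *ᵥ (fun i => (x i).im) -
      (fun i => (y i).im) ⬝ᵥ A *ᵥ (fun i => (x i).re) := by
    simp only [dotProduct, mulVec, Complex.re_sum, Pi.star_apply, Complex.mul_re, Complex.im_sum,
      Matrix.map_apply, Complex.mul_im, Complex.ofReal_re, Complex.ofReal_im, RCLike.star_def,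
      Complex.conj_re, Complex.conj_im, zero_mul, sub_zero, add_zero]
    rw [← Finset.sum_sub_distrib]
    refine Finset.sum_congr rfl fun i _ => by ring
  have h1 : |(star y ⬝ᵥ (A.map Complex.ofReal) *ᵥ x).re| ≤ 8 * M := by
    rw [ere, abs_le]; constructor <;> linarith
  have h2 : |(star y ⬝ᵥ (A.map Complex.ofReal) *ᵥ x).im| ≤ 8 * M := by
    rw [eim, abs_le]; constructor <;> linarith
  linarith

end net

lemma exp_sum_zero (m : ℕ) (hm : 0 < m) (k : ℤ) (hk : ¬ (m : ℤ) ∣ k) :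
    ∑ t : Fin m, Complex.exp (((2 * Real.pi * k * (t : ℕ) / m : ℝ) : ℂ) * Complex.I) = 0 := by
  have hm' : (m : ℂ) ≠ 0 := by exact_mod_cast hm.ne'
  set z : ℂ := Complex.exp (2 * Real.pi * k / m * Complex.I) with hz
  have h1 : z ≠ 1 := by
    intro h
    rw [hz, Complex.exp_eq_one_iff] at h
    obtain ⟨q, hq⟩ := h
    apply hk
    refine ⟨q, ?_⟩
    have hpi : (2 * Real.pi * Complex.I : ℂ) ≠ 0 := Complex.two_pi_I_ne_zero
    have : (k : ℂ) * (2 * Real.pi * Complex.I) = (m * q) * (2 * Real.pi * Complex.I) := by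
      have e := congrArg (fun w : ℂ => m * w) hq
      have : (m : ℂ) * (2 * Real.pi * k / m * Complex.I) = k * (2 * Real.pi * Complex.I) := by
        field_simp
      rw [← this, e]; ring
    have := mul_right_cancel₀ hpi this
    exact_mod_cast this
  have h2 : z ^ m = 1 := by
    rw [hz, ← Complex.exp_nat_mul, Complex.exp_eq_one_iff]
    exact ⟨k, by field_simp⟩
  have h3 : ∀ t : Fin m, Complex.exp (((2 * Real.pi * k * (t : ℕ) / m : ℝ) : ℂ) * Complex.I)
      = z ^ (t : ℕ) := by
    intro t
    rw [hz, ← Complex.exp_nat_mul]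
    congr 1; push_cast; ring
  rw [Finset.sum_congr rfl fun t _ => h3 t, Fin.sum_univ_eq_sum_range (fun t => z ^ t) m,
    geom_sum_eq h1, h2]
  simp

lemma cos_sum (m : ℕ) (hm : 0 < m) (k : ℤ) (hk : ¬ (m : ℤ) ∣ k) :
    ∑ t : Fin m, Real.cos (2 * Real.pi * k * (t : ℕ) / m) = 0 := by
  have := congrArg Complex.re (exp_sum_zero m hm k hk)
  simpa only [Complex.re_sum, Complex.exp_ofReal_mul_I_re, Complex.zero_re] using this

lemma sin_sum (m : ℕ) (hm : 0 < m) (k : ℤ) :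
    ∑ t : Fin m, Real.sin (2 * Real.pi * k * (t : ℕ) / m) = 0 := by
  by_cases hk : (m : ℤ) ∣ k
  · obtain ⟨q, rfl⟩ := hk
    refine Finset.sum_eq_zero fun t _ => ?_
    have : (2 * Real.pi * ((m * q : ℤ) : ℝ) * (t : ℕ) / m) = ((2 * (q * t) : ℤ) : ℝ) * Real.pi := by
      have : (m : ℝ) ≠ 0 := by exact_mod_cast hm.ne'
      push_cast
      field_simp
    rw [this, Real.sin_int_mul_pi]
  · have := congrArg Complex.im (exp_sum_zero m hm k hk)
    simpa only [Complex.im_sum, Complex.exp_ofReal_mul_I_im, Complex.zero_im] using this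

/-- The `cas` function. -/
noncomputable def cas (x : ℝ) : ℝ := Real.cos x + Real.sin x

lemma cas_mul (a b : ℝ) : cas a * cas b = Real.cos (a - b) + Real.sin (a + b) := by
  rw [cas, cas, Real.cos_sub, Real.sin_add]; ring

lemma cas_add (a b : ℝ) : cas (a + b) = Real.cos b * cas a + Real.sin b * cas (-a) := by
  simp only [cas, Real.cos_add, Real.sin_add, Real.cos_neg, Real.sin_neg]; ring

lemma cas_add_int (a : ℝ) (z : ℤ) : cas (a + z * (2 * Real.pi)) = cas a := by
  simp only [cas, Real.cos_add_int_mul_two_pi, Real.sin_add_int_mul_two_pi]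

/-- Hartley matrix. -/
noncomputable def hart (m : ℕ) : Matrix (Fin m) (Fin m) ℝ :=
  Matrix.of fun j w => cas (2 * Real.pi * (j : ℕ) * (w : ℕ) / m) / √m

lemma hart_symm (m : ℕ) (j w : Fin m) : hart m j w = hart m w j := by
  simp only [hart, Matrix.of_apply]; congr 2; ring

lemma hart_orth (m : ℕ) (j j' : Fin m) :
    ∑ w, hart m j w * hart m j' w = if j = j' then 1 else 0 := by
  have hm : 0 < m := j.pos
  have hmR : (0 : ℝ) < m := by exact_mod_cast hm
  have h : ∀ w : Fin m, hart m j w * hart m j' w =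
      (Real.cos (2 * Real.pi * (((j : ℕ) - (j' : ℕ) : ℤ) : ℝ) * (w : ℕ) / m)
        + Real.sin (2 * Real.pi * (((j : ℕ) + (j' : ℕ) : ℤ) : ℝ) * (w : ℕ) / m)) / m := by
    intro w
    simp only [hart, Matrix.of_apply]
    rw [div_mul_div_comm, Real.mul_self_sqrt hmR.le, cas_mul]
    congr 3 <;> push_cast <;> ring
  rw [Finset.sum_congr rfl fun w _ => h w, ← Finset.sum_div, Finset.sum_add_distrib,
    sin_sum m hm]
  split_ifs with hj
  · subst hj
    simp [hmR.ne']
  · rw [cos_sum m hm]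
    · simp
    · intro hd
      apply hj
      have h1 : |((j : ℕ) : ℤ) - ((j' : ℕ) : ℤ)| < m := by
        rw [abs_lt]; constructor <;> omega
      have := Int.eq_zero_of_abs_lt_dvd hd h1
      ext; omega

lemma hart_norm (m : ℕ) (g : Fin m → ℝ) :
    ∑ j, (∑ w, hart m j w * g w) ^ 2 = ∑ w, g w ^ 2 := by
  have : ∀ j, (∑ w, hart m j w * g w) ^ 2 =
      ∑ w, ∑ w', (hart m w j * hart m w' j) * (g w * g w') := by
    intro j
    rw [sq, Finset.sum_mul_sum]
    refine Finset.sum_congr rfl fun w _ => Finset.sum_congr rfl fun w' _ => ?_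
    rw [hart_symm m j w, hart_symm m j w']; ring
  rw [Finset.sum_congr rfl fun j _ => this j, Finset.sum_comm]
  refine Finset.sum_congr rfl fun w _ => ?_
  rw [Finset.sum_comm]
  simp_rw [← Finset.sum_mul, hart_orth]
  simp [sq]

lemma hart_mp (m : ℕ) (v : NNReal) :
    MeasurePreserving (fun g : Fin m → ℝ => fun j => ∑ w, hart m j w * g w)
      (Measure.pi fun _ => gaussianReal 0 v) (Measure.pi fun _ => gaussianReal 0 v) := by
  have hmeas : Measurable (fun g : Fin m → ℝ => fun j => ∑ w, hart m j w * g w) := by fun_prop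
  refine ⟨hmeas, ?_⟩
  have hinj : MeasurableEmbedding (WithLp.toLp 2 : (Fin m → ℝ) → EuclideanSpace ℝ (Fin m)) :=
    (MeasurableEquiv.toLp 2 (Fin m → ℝ)).measurableEmbedding
  have key : ((Measure.pi fun _ : Fin m => gaussianReal 0 v).map
      (fun g : Fin m → ℝ => fun j => ∑ w, hart m j w * g w)).map
        (WithLp.toLp 2 : (Fin m → ℝ) → EuclideanSpace ℝ (Fin m))
      = (Measure.pi fun _ : Fin m => gaussianReal 0 v).map (WithLp.toLp 2) := by
    apply Measure.ext_of_charFun (E := EuclideanSpace ℝ (Fin m))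
    ext t
    have hT : charFun (((Measure.pi fun _ : Fin m => gaussianReal 0 v).map
      (fun g : Fin m → ℝ => fun j => ∑ w, hart m j w * g w)).map
        (WithLp.toLp 2 : (Fin m → ℝ) → EuclideanSpace ℝ (Fin m))) t
      = charFun ((Measure.pi fun _ : Fin m => gaussianReal 0 v).map
        (WithLp.toLp 2 : (Fin m → ℝ) → EuclideanSpace ℝ (Fin m)))
        (WithLp.toLp 2 fun w => ∑ j, hart m w j * t j) := by
      rw [charFun_apply, charFun_apply, integral_map (by fun_prop) (by fun_prop),
        integral_map hmeas.aemeasurable (by fun_prop), integral_map (by fun_prop) (by fun_prop)]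
      refine integral_congr_ae (Filter.Eventually.of_forall fun g => ?_)
      simp only [PiLp.inner_apply, RCLike.inner_apply, conj_trivial]
      congr 3
      simp_rw [Finset.mul_sum, Finset.sum_mul]
      rw [Finset.sum_comm]
      refine Finset.sum_congr rfl fun w _ => Finset.sum_congr rfl fun j _ => ?_
      rw [hart_symm m j w]; ring
    rw [hT, charFun_pi, charFun_pi]
    simp_rw [charFun_gaussianReal, ← Complex.exp_sum]
    congr 1
    simp only [Complex.ofReal_zero, mul_zero, zero_mul, zero_sub]
    rw [Finset.sum_neg_distrib, Finset.sum_neg_distrib, ← Finset.sum_div, ← Finset.sum_div,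
      ← Finset.mul_sum, ← Finset.mul_sum]
    congr 3
    have := hart_norm m (fun j => t j)
    exact_mod_cast this
  have h2 := congrArg (Measure.comap
    (WithLp.toLp 2 : (Fin m → ℝ) → EuclideanSpace ℝ (Fin m))) key
  rwa [hinj.comap_map, hinj.comap_map] at h2

/-- Frequency-domain coefficients. -/
noncomputable def vv {p : ℕ} (n : ℕ) {m : ℕ} [NeZero m] (ψ : Fin p → Fin m → ℝ) (w : Fin m)
    (ik : Fin p × Fin n) : ℝ :=
  Real.cos (2 * Real.pi * ((n - 1 - (ik.2 : ℕ) : ℕ) : ℝ) * (w : ℕ) / m) * ψ ik.1 w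
    - Real.sin (2 * Real.pi * ((n - 1 - (ik.2 : ℕ) : ℕ) : ℝ) * (w : ℕ) / m) * ψ ik.1 (-w)

/-- Blockwise Hartley transform. -/
noncomputable def hblk {p m : ℕ} (ψ : Fin p → Fin m → ℝ) : Fin p → Fin m → ℝ :=
  fun i j => ∑ w, hart m j w * ψ i w

lemma neg_cast (m : ℕ) [NeZero m] (w : Fin m) :
    ∃ z : ℤ, (((-w : Fin m) : ℕ) : ℝ) = -((w : ℕ) : ℝ) + z * m := by
  by_cases h : w = 0
  · subst h; exact ⟨0, by simp⟩
  · refine ⟨1, ?_⟩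
    have hw := w.isLt
    have h0 : (w : ℕ) ≠ 0 := fun h' => h (Fin.ext (by simpa using h'))
    have : ((-w : Fin m) : ℕ) = m - w := by
      rw [Fin.val_neg']
      exact Nat.mod_eq_of_lt (by omega)
    rw [this, Nat.cast_sub hw.le]; push_cast; ring

lemma probe_hblk {p n m : ℕ} [NeZero m] (ψ : Fin p → Fin m → ℝ) (j : Fin m)
    (ik : Fin p × Fin n) :
    probeMatrix p n m (hblk ψ) j ik = ∑ w, hart m j w * vv n ψ w ik := by
  have hm : (m : ℝ) ≠ 0 := by exact_mod_cast NeZero.ne m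
  simp only [probeMatrix, hblk, Matrix.of_apply, vv]
  set l : ℕ := n - 1 - (ik.2 : ℕ) with hl
  have h1 : ∀ w : Fin m, hart m ⟨(l + (j : ℕ)) % m, Nat.mod_lt _ j.pos⟩ w * ψ ik.1 w
      = hart m j w * (Real.cos (2 * Real.pi * (l : ℝ) * (w : ℕ) / m) * ψ ik.1 w)
       + (Real.sin (2 * Real.pi * (l : ℝ) * (w : ℕ) / m) *
          (cas (-(2 * Real.pi * (j : ℕ) * (w : ℕ) / m)) / √m)) * ψ ik.1 w := by
    intro w
    have hdiv : (((l + (j : ℕ)) % m : ℕ) : ℝ) = l + (j : ℕ) - m * (((l + (j : ℕ)) / m : ℕ) : ℝ) := by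
      have := Nat.mod_add_div (l + (j : ℕ)) m
      have h2 : (((l + (j : ℕ)) % m : ℕ) : ℝ) + m * (((l + (j : ℕ)) / m : ℕ) : ℝ)
        = l + (j : ℕ) := by exact_mod_cast this
      linarith
    have harg : 2 * Real.pi * (((l + (j : ℕ)) % m : ℕ) : ℝ) * (w : ℕ) / m
        = (2 * Real.pi * (j : ℕ) * (w : ℕ) / m + 2 * Real.pi * (l : ℝ) * (w : ℕ) / m)
          + ((-((((l + (j : ℕ)) / m : ℕ) : ℤ) * (w : ℕ)) : ℤ) : ℝ) * (2 * Real.pi) := by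
      rw [hdiv]
      generalize (l + (j : ℕ)) / m = d
      push_cast; field_simp; ring
    simp only [hart, Matrix.of_apply]
    rw [harg, cas_add_int, cas_add]
    ring
  rw [Finset.sum_congr rfl fun w _ => h1 w, Finset.sum_add_distrib]
  simp_rw [mul_sub]
  rw [Finset.sum_sub_distrib, sub_eq_add_neg]
  congr 1
  rw [← Equiv.sum_comp (Equiv.neg (Fin m)), ← Finset.sum_neg_distrib]
  refine Finset.sum_congr rfl fun w _ => ?_
  obtain ⟨z, hz⟩ := neg_cast m w
  simp only [Equiv.neg_apply, hart, Matrix.of_apply]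
  have e1 : 2 * Real.pi * (l : ℝ) * (((-w : Fin m) : ℕ) : ℝ) / m
      = -(2 * Real.pi * (l : ℝ) * (w : ℕ) / m) + ((l * z : ℤ) : ℝ) * (2 * Real.pi) := by
    rw [hz]; push_cast; field_simp
  have e2 : -(2 * Real.pi * ((j : ℕ) : ℝ) * (((-w : Fin m) : ℕ) : ℝ) / m)
      = (2 * Real.pi * ((j : ℕ) : ℝ) * (w : ℕ) / m)
        + ((-((j : ℕ) * z) : ℤ) : ℝ) * (2 * Real.pi) := by
    rw [hz]; push_cast; field_simp; ring
  rw [e1, e2, cas_add_int, Real.sin_add_int_mul_two_pi, Real.sin_neg]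
  ring

/-- Energy of the probe matrix on a vector. -/
noncomputable def energy {p n m : ℕ} (φ : Fin p → Fin m → ℝ) (x : Fin p × Fin n → ℝ) : ℝ :=
  ∑ j, (∑ ik, probeMatrix p n m φ j ik * x ik) ^ 2

lemma energy_hblk {p n m : ℕ} [NeZero m] (ψ : Fin p → Fin m → ℝ) (x : Fin p × Fin n → ℝ) :
    energy (hblk ψ) x = ∑ w, (∑ ik, vv n ψ w ik * x ik) ^ 2 := by
  rw [energy, ← hart_norm m fun w => ∑ ik, vv n ψ w ik * x ik]
  refine Finset.sum_congr rfl fun j _ => ?_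
  congr 1
  simp_rw [probe_hblk, Finset.sum_mul, Finset.mul_sum]
  rw [Finset.sum_comm]
  refine Finset.sum_congr rfl fun w _ => Finset.sum_congr rfl fun ik _ => by ring

lemma quad_energy {p n m : ℕ} (φ : Fin p → Fin m → ℝ) (x : Fin p × Fin n → ℝ) :
    x ⬝ᵥ (1 - (probeMatrix p n m φ)ᵀ * probeMatrix p n m φ) *ᵥ x
      = ∑ i, x i ^ 2 - energy φ x := by
  rw [Matrix.sub_mulVec, dotProduct_sub, Matrix.one_mulVec, ← Matrix.mulVec_mulVec,
    Matrix.dotProduct_mulVec, Matrix.vecMul_transpose]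
  simp only [dotProduct, energy, Matrix.mulVec, sq]

/-- Representative of a frequency up to sign. -/
def frep {m : ℕ} [NeZero m] (w : Fin m) : Fin m := min w (-w)

lemma frep_neg {m : ℕ} [NeZero m] (w : Fin m) : frep (-w) = frep w := by
  simp only [frep, neg_neg, min_comm]

lemma frep_fiber {m : ℕ} [NeZero m] (r : Fin m) :
    (Finset.univ.filter fun w : Fin m => frep w = r).card ≤ 2 := by
  refine le_trans (Finset.card_le_card (t := {r, -r}) ?_) Finset.card_le_two
  intro w hw
  have hw : min w (-w) = r := (Finset.mem_filter.1 hw).2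
  simp only [Finset.mem_insert, Finset.mem_singleton]
  rcases min_choice w (-w) with h | h
  · left; rw [← hw, h]
  · right; rw [← hw, h, neg_neg]

/-- Coordinate swap. -/
def fswap {p m : ℕ} [NeZero m] (η : Fin m → Bool)
    (q : (Fin p → Fin m → ℝ) × (Fin p → Fin m → ℝ)) :
    (Fin p → Fin m → ℝ) × (Fin p → Fin m → ℝ) :=
  (fun i w => if η (frep w) then q.1 i w else q.2 i w,
   fun i w => if η (frep w) then q.2 i w else q.1 i w)

lemma vv_swap {p n m : ℕ} [NeZero m] (η : Fin m → Bool)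
    (q : (Fin p → Fin m → ℝ) × (Fin p → Fin m → ℝ)) (x : Fin p × Fin n → ℝ) :
    (∑ w, (∑ ik, vv n (fswap η q).1 w ik * x ik) ^ 2)
      - (∑ w, (∑ ik, vv n (fswap η q).2 w ik * x ik) ^ 2)
    = (∑ w, bsgn (η (frep w)) * (∑ ik, vv n q.1 w ik * x ik) ^ 2)
      - (∑ w, bsgn (η (frep w)) * (∑ ik, vv n q.2 w ik * x ik) ^ 2) := by
  rw [← Finset.sum_sub_distrib, ← Finset.sum_sub_distrib]
  refine Finset.sum_congr rfl fun w _ => ?_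
  simp only [vv, fswap, frep_neg]
  cases η (frep w)
  · simp [bsgn]; ring
  · simp [bsgn]

lemma pi_prod_mp {ι α : Type*} [Fintype ι] [MeasurableSpace α] (ν : Measure α) [SigmaFinite ν]
    (T : ι → α × α → α × α) (hT : ∀ i, MeasurePreserving (T i) (ν.prod ν) (ν.prod ν)) :
    MeasurePreserving (fun q : (ι → α) × (ι → α) =>
      ((fun i => (T i (q.1 i, q.2 i)).1, fun i => (T i (q.1 i, q.2 i)).2) : (ι → α) × (ι → α)))
      ((Measure.pi fun _ => ν).prod (Measure.pi fun _ => ν))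
      ((Measure.pi fun _ => ν).prod (Measure.pi fun _ => ν)) := by
  have h1 := measurePreserving_arrowProdEquivProdArrow α α ι (fun _ => ν) (fun _ => ν)
  have h2 := measurePreserving_pi (fun _ : ι => ν.prod ν) (fun _ : ι => ν.prod ν) hT
  exact (h1.comp h2).comp (h1.symm _)

lemma fswap_mp {p m : ℕ} [NeZero m] (η : Fin m → Bool) :
    MeasurePreserving (fswap (p := p) η) ((gaussMeasure p m).prod (gaussMeasure p m))
      ((gaussMeasure p m).prod (gaussMeasure p m)) := by
  have h1 := pi_prod_mp (ι := Fin m) (gaussianReal 0 ((m : NNReal))⁻¹)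
    (fun w q => if η (frep w) then q else q.swap) (by
      intro w
      cases η (frep w)
      · simpa using Measure.measurePreserving_swap
      · simpa using! MeasurePreserving.id _)
  have h2 := pi_prod_mp (ι := Fin p) (Measure.pi fun _ : Fin m => gaussianReal 0 ((m : NNReal))⁻¹)
    (fun _ => _) (fun _ => h1)
  have e : fswap (p := p) η = fun q : (Fin p → Fin m → ℝ) × (Fin p → Fin m → ℝ) =>
      ((fun i w => (if η (frep w) then (q.1 i w, q.2 i w) else (q.1 i w, q.2 i w).swap).1,
        fun i w => (if η (frep w) then (q.1 i w, q.2 i w) else (q.1 i w, q.2 i w).swap).2) :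
        (Fin p → Fin m → ℝ) × (Fin p → Fin m → ℝ)) := by
    ext q i w
    · simp only [fswap]; split_ifs <;> rfl
    · simp only [fswap]; split_ifs <;> rfl
  rw [e]
  exact h2

lemma hblk_mp {p m : ℕ} :
    MeasurePreserving (hblk (p := p) (m := m)) (gaussMeasure p m) (gaussMeasure p m) := by
  exact measurePreserving_pi _ _ fun _ => hart_mp m _

instance gauss_prob (p m : ℕ) : IsProbabilityMeasure (gaussMeasure p m) := by
  unfold gaussMeasure; infer_instance

lemma coord_mp {p m : ℕ} (i : Fin p) (w : Fin m) :
    MeasurePreserving (fun φ : Fin p → Fin m → ℝ => φ i w) (gaussMeasure p m)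
      (gaussianReal 0 ((m : NNReal))⁻¹) := by
  have h1 := measurePreserving_eval (fun _ : Fin p =>
    (Measure.pi fun _ : Fin m => gaussianReal 0 ((m : NNReal))⁻¹)) i
  have h2 := measurePreserving_eval (fun _ : Fin m => gaussianReal 0 ((m : NNReal))⁻¹) w
  exact h2.comp h1

lemma coord_memLp {p m : ℕ} (i : Fin p) (w : Fin m) :
    MemLp (fun φ : Fin p → Fin m → ℝ => φ i w) 2 (gaussMeasure p m) :=
  (memLp_id_gaussianReal 2).comp_measurePreserving (coord_mp i w)

lemma coord_mul_int {p m : ℕ} (i i' : Fin p) (w w' : Fin m) :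
    Integrable (fun φ : Fin p → Fin m → ℝ => φ i w * φ i' w') (gaussMeasure p m) :=
  (coord_memLp i w).integrable_mul (coord_memLp i' w')

lemma coord_sq {p m : ℕ} (i : Fin p) (w : Fin m) :
    ∫ φ, φ i w * φ i w ∂(gaussMeasure p m) = (m : ℝ)⁻¹ := by
  have h := variance_id_gaussianReal (μ := 0) (v := ((m : NNReal))⁻¹)
  rw [variance_eq_integral aemeasurable_id] at h
  simp only [id, integral_id_gaussianReal, sub_zero, NNReal.coe_inv, NNReal.coe_natCast] at h
  rw [← h, ← (coord_mp i w).map_eq,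
    integral_map (coord_mp i w).measurable.aemeasurable (by fun_prop)]
  simp only [sq]

lemma flip_mp {p m : ℕ} (i : Fin p) (w : Fin m) :
    MeasurePreserving (fun φ : Fin p → Fin m → ℝ =>
      fun a b => (if a = i ∧ b = w then (fun x : ℝ => -x) else id) (φ a b))
      (gaussMeasure p m) (gaussMeasure p m) := by
  refine measurePreserving_pi (fun _ : Fin p => Measure.pi fun _ : Fin m =>
    gaussianReal 0 ((m : NNReal))⁻¹) (fun _ : Fin p => Measure.pi fun _ : Fin m =>
    gaussianReal 0 ((m : NNReal))⁻¹) (f := fun a (g : Fin m → ℝ) b =>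
      (if a = i ∧ b = w then (fun x : ℝ => -x) else id) (g b)) fun a => ?_
  refine measurePreserving_pi (fun _ : Fin m => gaussianReal 0 ((m : NNReal))⁻¹)
    (fun _ : Fin m => gaussianReal 0 ((m : NNReal))⁻¹) (f := fun b (g : ℝ) =>
      (if a = i ∧ b = w then (fun x : ℝ => -x) else id) g) fun b => ?_
  split_ifs
  · refine ⟨by fun_prop, ?_⟩
    rw [gaussianReal_map_neg]; simp
  · exact MeasurePreserving.id _

lemma coord_cross {p m : ℕ} (i i' : Fin p) (w w' : Fin m) (h : ¬ (i' = i ∧ w' = w)) :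
    ∫ φ, φ i w * φ i' w' ∂(gaussMeasure p m) = 0 := by
  have hm := flip_mp (p := p) (m := m) i w
  have h1 : ∫ φ, φ i w * φ i' w' ∂(gaussMeasure p m)
      = ∫ φ, -(φ i w * φ i' w') ∂(gaussMeasure p m) := by
    conv_lhs => rw [← hm.map_eq]
    rw [integral_map hm.measurable.aemeasurable (by fun_prop)]
    refine integral_congr_ae (Filter.Eventually.of_forall fun φ => ?_)
    simp [h]
  rw [integral_neg] at h1
  linarith

lemma energy_expand {p n m : ℕ} (φ : Fin p → Fin m → ℝ) (x : Fin p × Fin n → ℝ) :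
    energy φ x = ∑ j, ∑ a, ∑ b, (probeMatrix p n m φ j a * probeMatrix p n m φ j b)
      * (x a * x b) := by
  simp only [energy, sq, Finset.sum_mul_sum]
  refine Finset.sum_congr rfl fun j _ => Finset.sum_congr rfl fun a _ =>
    Finset.sum_congr rfl fun b _ => by ring

lemma energy_int {p n m : ℕ} (x : Fin p × Fin n → ℝ) :
    Integrable (fun φ => energy (n := n) φ x) (gaussMeasure p m) := by
  simp only [energy_expand]
  refine integrable_finsetSum _ fun j _ => integrable_finsetSum _ fun a _ =>
    integrable_finsetSum _ fun b _ => Integrable.mul_const ?_ _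
  exact coord_mul_int _ _ _ _

lemma energy_mean {p n m : ℕ} (hn : n ≤ m) (hm : 0 < m) (x : Fin p × Fin n → ℝ) :
    ∫ φ, energy φ x ∂(gaussMeasure p m) = ∑ a, x a ^ 2 := by
  have hI : ∀ (j : Fin m) (a b : Fin p × Fin n), Integrable (fun φ =>
      (probeMatrix p n m φ j a * probeMatrix p n m φ j b) * (x a * x b)) (gaussMeasure p m) :=
    fun j a b => Integrable.mul_const (coord_mul_int _ _ _ _) _
  simp only [energy_expand]
  rw [integral_finsetSum _ fun j _ => integrable_finsetSum _ fun a _ =>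
    integrable_finsetSum _ fun b _ => hI j a b]
  have key : ∀ j : Fin m, ∫ φ, (∑ a, ∑ b, (probeMatrix p n m φ j a * probeMatrix p n m φ j b)
      * (x a * x b)) ∂(gaussMeasure p m) = (∑ a, x a ^ 2) * (m : ℝ)⁻¹ := by
    intro j
    rw [integral_finsetSum _ fun a _ => integrable_finsetSum _ fun b _ => hI j a b, Finset.sum_mul]
    refine Finset.sum_congr rfl fun a _ => ?_
    rw [integral_finsetSum _ fun b _ => hI j a b, Finset.sum_eq_single a]
    · rw [integral_mul_const]
      simp only [probeMatrix, Matrix.of_apply]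
      rw [coord_sq]; ring
    · intro b _ hb
      rw [integral_mul_const]
      simp only [probeMatrix, Matrix.of_apply]
      rw [coord_cross, zero_mul]
      rintro ⟨h1, h2⟩
      apply hb
      have h3 : (n - 1 - (b.2 : ℕ) + (j : ℕ)) % m = (n - 1 - (a.2 : ℕ) + (j : ℕ)) % m := by
        simpa using congrArg Fin.val h2
      have h4 : (n - 1 - (b.2 : ℕ)) ≡ (n - 1 - (a.2 : ℕ)) [MOD m] :=
        Nat.ModEq.add_right_cancel' (j : ℕ) h3
      have hb2 := b.2.isLt
      have ha2 := a.2.isLt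
      have h5 := Nat.ModEq.eq_of_lt_of_lt h4 (by omega) (by omega)
      exact Prod.ext h1 (Fin.ext (by omega))
    · simp
  rw [Finset.sum_congr rfl fun j _ => key j]
  have : (m : ℝ) ≠ 0 := by exact_mod_cast hm.ne'
  simp
  field_simp

lemma exp_moment {m : ℕ} (hm : 0 < m) :
    ∫ x, Real.exp (m * x ^ 2 / 4) ∂(gaussianReal 0 ((m : NNReal))⁻¹) = √2 := by
  have hm' : ((m : NNReal))⁻¹ ≠ 0 := by simp [hm.ne']
  have hmR : (0 : ℝ) < m := by exact_mod_cast hm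
  rw [integral_gaussianReal_eq_integral_smul hm']
  have : ∀ x : ℝ, gaussianPDFReal 0 ((m : NNReal))⁻¹ x • Real.exp (m * x ^ 2 / 4)
      = (√(2 * Real.pi * (m : ℝ)⁻¹))⁻¹ * Real.exp (-(m / 4) * x ^ 2) := by
    intro x
    simp only [gaussianPDFReal, smul_eq_mul, sub_zero, NNReal.coe_inv, NNReal.coe_natCast]
    rw [mul_assoc, ← Real.exp_add]
    congr 2
    field_simp; ring
  simp_rw [this]
  rw [integral_const_mul, integral_gaussian, ← Real.sqrt_inv, ← Real.sqrt_mul (by positivity)]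
  congr 1
  have := Real.pi_pos
  field_simp; norm_num

/-- The squared envelope. -/
noncomputable def ksq {p m : ℕ} (ψ : Fin p → Fin m → ℝ) : ℝ :=
  16 / m * (Real.log (m * p) + (∑ i, ∑ w, Real.exp (m * ψ i w ^ 2 / 4)) / (m * p))

lemma ksq_term_int {p m : ℕ} (i : Fin p) (w : Fin m) :
    Integrable (fun ψ : Fin p → Fin m → ℝ => Real.exp (m * ψ i w ^ 2 / 4)) (gaussMeasure p m) := by
  have h : Integrable (fun x : ℝ => Real.exp (m * x ^ 2 / 4))
      (gaussianReal 0 ((m : NNReal))⁻¹) := by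
    by_contra hc
    have := integral_undef hc
    rw [exp_moment w.pos] at this
    have h2 : (0 : ℝ) < √2 := by positivity
    linarith
  exact (coord_mp i w).integrable_comp_of_integrable h

lemma ksq_int {p m : ℕ} : Integrable (fun ψ => ksq ψ) (gaussMeasure p m) := by
  unfold ksq
  refine Integrable.const_mul (Integrable.add (integrable_const _) (Integrable.div_const ?_ _)) _
  exact integrable_finsetSum _ fun i _ => integrable_finsetSum _ fun w _ => ksq_term_int i w

lemma ksq_mean {p m : ℕ} (hp : 1 ≤ p) (hm : 2 ≤ m) :
    ∫ ψ, ksq ψ ∂(gaussMeasure p m) ≤ 64 * Real.log (m * p) / m := by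
  have hmR : (0 : ℝ) < m := by exact_mod_cast (by omega : 0 < m)
  have hpR : (0 : ℝ) < p := by exact_mod_cast hp
  unfold ksq
  rw [integral_const_mul, integral_add (integrable_const _) (Integrable.div_const
    (integrable_finsetSum _ fun i _ => integrable_finsetSum _ fun w _ => ksq_term_int i w) _),
    integral_div, integral_finsetSum _ fun i _ => integrable_finsetSum _ fun w _ =>
      ksq_term_int i w]
  have h1 : ∀ i : Fin p, ∫ ψ : Fin p → Fin m → ℝ, (∑ w, Real.exp (m * ψ i w ^ 2 / 4))
      ∂(gaussMeasure p m) = m * √2 := by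
    intro i
    rw [integral_finsetSum _ fun w _ => ksq_term_int i w]
    have : ∀ w : Fin m, ∫ ψ : Fin p → Fin m → ℝ, Real.exp (m * ψ i w ^ 2 / 4)
        ∂(gaussMeasure p m) = √2 := by
      intro w
      rw [← exp_moment (by omega : 0 < m), ← (coord_mp i w).map_eq,
        integral_map (coord_mp i w).measurable.aemeasurable (by fun_prop)]
    simp [this]
  simp only [h1]
  simp only [integral_const, Finset.sum_const, Finset.card_univ, Fintype.card_fin, smul_eq_mul,
    probReal_univ, one_mul, nsmul_eq_mul]
  have h2 : (p : ℝ) * (m * √2) / (m * p) = √2 := by field_simp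
  rw [h2]
  have h3 : √2 ≤ 2 := by
    rw [Real.sqrt_le_left (by norm_num)]; norm_num
  have h4 : Real.log 2 ≤ Real.log (m * p) := by
    apply Real.log_le_log (by norm_num)
    have : (2 : ℝ) ≤ m := by exact_mod_cast hm
    have : (1 : ℝ) ≤ p := by exact_mod_cast hp
    nlinarith
  have h5 := Real.log_two_gt_d9
  rw [div_mul_eq_mul_div]
  gcongr ?_ / _
  linarith

lemma ksq_pos {p m : ℕ} (hp : 1 ≤ p) (hm : 2 ≤ m) (ψ : Fin p → Fin m → ℝ) : 0 < ksq ψ := by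
  have hmR : (2 : ℝ) ≤ m := by exact_mod_cast hm
  have hpR : (1 : ℝ) ≤ p := by exact_mod_cast hp
  have h4 : 0 < Real.log (m * p) := Real.log_pos (by nlinarith)
  unfold ksq
  have : 0 ≤ ∑ i, ∑ w, Real.exp (m * ψ i w ^ 2 / 4) := by positivity
  positivity

lemma ksq_bound {p m : ℕ} (hp : 1 ≤ p) (hm : 2 ≤ m) (ψ : Fin p → Fin m → ℝ)
    (i : Fin p) (w : Fin m) : 2 * |ψ i w| ≤ √(ksq ψ) := by
  have hmR : (2 : ℝ) ≤ m := by exact_mod_cast hm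
  have hpR : (1 : ℝ) ≤ p := by exact_mod_cast hp
  have hM : (0 : ℝ) < m * p := by positivity
  apply Real.le_sqrt_of_sq_le
  have h1 := le_log_add_exp (m * ψ i w ^ 2 / 4) (m * p) hM
  have h2 : Real.exp (m * ψ i w ^ 2 / 4) ≤ ∑ i, ∑ w, Real.exp (m * ψ i w ^ 2 / 4) := by
    refine le_trans ?_ (Finset.single_le_sum (f := fun i => ∑ w, Real.exp (m * ψ i w ^ 2 / 4))
      (fun i _ => by positivity) (Finset.mem_univ i))
    exact Finset.single_le_sum (f := fun w => Real.exp (m * ψ i w ^ 2 / 4))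
      (fun i _ => by positivity) (Finset.mem_univ w)
  have h3 : m * ψ i w ^ 2 / 4 ≤ Real.log (m * p) +
      (∑ i, ∑ w, Real.exp (m * ψ i w ^ 2 / 4)) / (m * p) := by
    have := div_le_div_of_nonneg_right h2 hM.le
    linarith
  have h4 := mul_le_mul_of_nonneg_left h3 (by positivity : (0 : ℝ) ≤ 16 / m)
  unfold ksq
  refine le_trans (le_of_eq ?_) h4
  rw [mul_pow, sq_abs]
  field_simp; ring

lemma vv_bound {p n m : ℕ} [NeZero m] (hp : 1 ≤ p) (hm : 2 ≤ m) (ψ : Fin p → Fin m → ℝ)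
    (w : Fin m) (ik : Fin p × Fin n) : |vv n ψ w ik| ≤ √(ksq ψ) := by
  have h1 := ksq_bound hp hm ψ ik.1 w
  have h2 := ksq_bound hp hm ψ ik.1 (-w)
  unfold vv
  refine (abs_sub _ _).trans ?_
  rw [abs_mul, abs_mul]
  have h3 := mul_le_of_le_one_left (abs_nonneg (ψ ik.1 w)) (Real.abs_cos_le_one
    (2 * Real.pi * ((n - 1 - (ik.2 : ℕ) : ℕ) : ℝ) * (w : ℕ) / m))
  have h4 := mul_le_of_le_one_left (abs_nonneg (ψ ik.1 (-w))) (Real.abs_sin_le_one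
    (2 * Real.pi * ((n - 1 - (ik.2 : ℕ) : ℕ) : ℝ) * (w : ℕ) / m))
  linarith

lemma energy_cont {p n m : ℕ} (x : Fin p × Fin n → ℝ) :
    Continuous fun φ : Fin p → Fin m → ℝ => energy (n := n) φ x := by
  simp only [energy, probeMatrix, Matrix.of_apply]
  fun_prop

lemma hblk_cont {p m : ℕ} : Continuous (hblk (p := p) (m := m)) := by
  unfold hblk; fun_prop

lemma vv_cont {p n m : ℕ} [NeZero m] (w : Fin m) (ik : Fin p × Fin n) :
    Continuous fun ψ : Fin p → Fin m → ℝ => vv n ψ w ik := by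
  unfold vv; fun_prop

/-- Energy in the frequency domain. -/
noncomputable def fen {p n m : ℕ} (x : Fin p × Fin n → ℝ) (ψ : Fin p → Fin m → ℝ) : ℝ :=
  energy (hblk ψ) x

lemma fen_cont {p n m : ℕ} (x : Fin p × Fin n → ℝ) :
    Continuous (fen (m := m) x) := (energy_cont x).comp hblk_cont

lemma fen_int {p n m : ℕ} (x : Fin p × Fin n → ℝ) :
    Integrable (fen (m := m) x) (gaussMeasure p m) :=
  hblk_mp.integrable_comp_of_integrable (energy_int x)

lemma fen_mean {p n m : ℕ} (hn : n ≤ m) (hm : 0 < m) (x : Fin p × Fin n → ℝ) :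
    ∫ ψ, fen x ψ ∂(gaussMeasure p m) = ∑ a, x a ^ 2 := by
  rw [← energy_mean hn hm x]
  conv_rhs => rw [← (hblk_mp (p := p) (m := m)).map_eq]
  rw [integral_map hblk_mp.measurable.aemeasurable (energy_cont x).aestronglyMeasurable]
  rfl

lemma fen_nonneg {p n m : ℕ} (x : Fin p × Fin n → ℝ) (ψ : Fin p → Fin m → ℝ) : 0 ≤ fen x ψ := by
  unfold fen energy; positivity

/-- Signed energy. -/
noncomputable def sen {p n m : ℕ} [NeZero m] (η : Fin m → Bool) (x : Fin p × Fin n → ℝ)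
    (ψ : Fin p → Fin m → ℝ) : ℝ :=
  ∑ w, bsgn (η (frep w)) * (∑ ik, vv n ψ w ik * x ik) ^ 2

lemma sen_cont {p n m : ℕ} [NeZero m] (η : Fin m → Bool) (x : Fin p × Fin n → ℝ) :
    Continuous (sen (m := m) η x) := by
  unfold sen
  have := fun (w : Fin m) (ik : Fin p × Fin n) => vv_cont (p := p) (m := m) w ik
  fun_prop

lemma sen_abs {p n m : ℕ} [NeZero m] (η : Fin m → Bool) (x : Fin p × Fin n → ℝ)
    (ψ : Fin p → Fin m → ℝ) : |sen η x ψ| ≤ fen x ψ := by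
  rw [fen, energy_hblk, sen]
  refine (Finset.abs_sum_le_sum_abs _ _).trans (Finset.sum_le_sum fun w _ => ?_)
  rw [abs_mul, abs_sq]
  refine le_of_eq ?_
  cases η (frep w) <;> simp [bsgn]

lemma fen_swap {p n m : ℕ} [NeZero m] (η : Fin m → Bool)
    (q : (Fin p → Fin m → ℝ) × (Fin p → Fin m → ℝ)) (x : Fin p × Fin n → ℝ) :
    fen x (fswap η q).1 - fen x (fswap η q).2 = sen η x q.1 - sen η x q.2 := by
  simp only [fen, energy_hblk, sen]
  exact vv_swap η q x

/-- Integrability of a finite supremum of continuous functions dominated by integrable ones. -/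
lemma sup_int {X ι : Type*} [TopologicalSpace X] [MeasurableSpace X] [OpensMeasurableSpace X]
    (μ : Measure X) (T : Finset ι) (hT : T.Nonempty) (f g : ι → X → ℝ)
    (hf : ∀ i, Continuous (f i)) (hg : ∀ i, Integrable (g i) μ) (hfg : ∀ i a, |f i a| ≤ g i a) :
    Integrable (fun a => T.sup' hT fun i => |f i a|) μ := by
  refine Integrable.mono' (integrable_finsetSum T fun i _ => hg i) ?_ ?_
  · apply Continuous.aestronglyMeasurable
    exact Continuous.finset_sup'_apply hT fun i _ => (hf i).abs
  · refine Filter.Eventually.of_forall fun a => ?_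
    obtain ⟨i, hi, h⟩ := T.exists_mem_eq_sup' hT fun i => |f i a|
    rw [h, Real.norm_eq_abs, abs_abs]
    exact (hfg i a).trans (Finset.single_le_sum (f := fun i => g i a)
      (fun j _ => (abs_nonneg _).trans (hfg j a)) hi)

lemma fsub_cont {p n m : ℕ} (x : Fin p × Fin n → ℝ) :
    Continuous fun q : (Fin p → Fin m → ℝ) × (Fin p → Fin m → ℝ) => fen x q.1 - fen x q.2 :=
  ((fen_cont x).comp continuous_fst).sub ((fen_cont x).comp continuous_snd)

lemma fsub_abs {p n m : ℕ} (x : Fin p × Fin n → ℝ)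
    (q : (Fin p → Fin m → ℝ) × (Fin p → Fin m → ℝ)) :
    |fen x q.1 - fen x q.2| ≤ fen x q.1 + fen x q.2 := by
  have h1 := fen_nonneg x q.1
  have h2 := fen_nonneg x q.2
  rw [abs_le]; constructor <;> linarith

section symm
variable {p n m : ℕ} [NeZero m] (T : Finset (Fin p × Fin n → ℝ)) (hT : T.Nonempty)

lemma symm_ineq (hn : n ≤ m) (η : Fin m → Bool) :
    ∫ ψ, (T.sup' hT fun x => |∑ a, x a ^ 2 - fen x ψ|) ∂(gaussMeasure p m)
      ≤ 2 * ∫ ψ, (T.sup' hT fun x => |sen η x ψ|) ∂(gaussMeasure p m) := by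
  have hm : 0 < m := Nat.pos_of_ne_zero (NeZero.ne m)
  set μ := gaussMeasure p m with hμ
  set N : (Fin p → Fin m → ℝ) × (Fin p → Fin m → ℝ) → ℝ :=
    fun q => T.sup' hT fun x => |fen x q.1 - fen x q.2| with hN
  have hgI : ∀ x : Fin p × Fin n → ℝ, Integrable
      (fun q : (Fin p → Fin m → ℝ) × (Fin p → Fin m → ℝ) => fen x q.1 + fen x q.2) (μ.prod μ) :=
    fun x => ((fen_int x).comp_fst μ).add ((fen_int x).comp_snd μ)
  have hNI : Integrable N (μ.prod μ) :=
    sup_int (μ.prod μ) T hT (fun x q => fen x q.1 - fen x q.2) _ (fun x => fsub_cont x) hgI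
      (fun x q => fsub_abs x q)
  have hMI : Integrable (fun ψ => T.sup' hT fun x => |∑ a, x a ^ 2 - fen x ψ|) μ :=
    sup_int μ T hT (fun x ψ => ∑ a, x a ^ 2 - fen x ψ) (fun x ψ => ∑ a, x a ^ 2 + fen x ψ)
      (fun x => continuous_const.sub (fen_cont x))
      (fun x => (integrable_const _).add (fen_int x))
      (fun x ψ => by
        have h1 := fen_nonneg x ψ
        have h2 : 0 ≤ ∑ a, x a ^ 2 := by positivity
        rw [abs_le]; constructor <;> linarith)
  have hRI : Integrable (fun ψ => T.sup' hT fun x => |sen η x ψ|) μ :=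
    sup_int μ T hT (fun x ψ => sen η x ψ) (fun x ψ => fen x ψ)
      (fun x => sen_cont η x) (fun x => fen_int x) (fun x ψ => sen_abs η x ψ)
  have h1 : ∫ ψ, (T.sup' hT fun x => |∑ a, x a ^ 2 - fen x ψ|) ∂μ ≤ ∫ q, N q ∂(μ.prod μ) := by
    rw [integral_prod _ hNI]
    refine integral_mono_ae hMI hNI.integral_prod_left ?_
    filter_upwards [hNI.prod_right_ae] with ψ hψ
    apply Finset.sup'_le
    intro x hx
    have e : ∑ a, x a ^ 2 - fen x ψ = ∫ ψ', (fen x ψ' - fen x ψ) ∂μ := by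
      rw [integral_sub (fen_int x) (integrable_const _), fen_mean hn hm]
      simp
    rw [e]
    refine (abs_integral_le_integral_abs).trans ?_
    refine integral_mono ((fen_int x).sub (integrable_const _)).abs hψ fun ψ' => ?_
    simp only [hN]
    rw [abs_sub_comm]
    exact Finset.le_sup' (fun x => |fen x ψ - fen x ψ'|) hx
  have hsw := fswap_mp (p := p) η
  have h2 : ∫ q, N q ∂(μ.prod μ) = ∫ q, N (fswap η q) ∂(μ.prod μ) := by
    conv_lhs => rw [← hsw.map_eq]
    refine integral_map hsw.measurable.aemeasurable ?_
    rw [hsw.map_eq]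
    exact hNI.aestronglyMeasurable
  have h3 : ∫ q, N (fswap η q) ∂(μ.prod μ)
      ≤ ∫ q, ((T.sup' hT fun x => |sen η x q.1|) + (T.sup' hT fun x => |sen η x q.2|))
        ∂(μ.prod μ) := by
    refine integral_mono (hsw.integrable_comp_of_integrable hNI)
      ((hRI.comp_fst μ).add (hRI.comp_snd μ)) fun q => ?_
    simp only [hN]
    apply Finset.sup'_le
    intro x hx
    rw [fen_swap]
    refine (abs_sub _ _).trans (add_le_add ?_ ?_)
    · exact Finset.le_sup' (fun x => |sen η x q.1|) hx
    · exact Finset.le_sup' (fun x => |sen η x q.2|) hx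
  rw [integral_add (hRI.comp_fst μ) (hRI.comp_snd μ), integral_fun_fst
    (f := fun ψ => T.sup' hT fun x => |sen η x ψ|), integral_fun_snd
    (f := fun ψ => T.sup' hT fun x => |sen η x ψ|)] at h3
  simp only [probReal_univ, one_smul] at h3
  linarith

end symm

lemma snormS_nonneg {ι : Type*} [Fintype ι] (s : ℕ) (A : Matrix ι ι ℂ) : 0 ≤ snormS s A := by
  apply Real.sSup_nonneg
  rintro r ⟨_, _, _, _, _, _, _, _, rfl⟩
  exact norm_nonneg _

lemma snormS_min {ι : Type*} [Fintype ι] (s : ℕ) (A : Matrix ι ι ℂ) :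
    snormS s A = snormS (min s (Fintype.card ι)) A := by
  unfold snormS
  have : ∀ Γ : Finset ι, (Γ.card ≤ s ↔ Γ.card ≤ min s (Fintype.card ι)) := fun Γ => by
    rw [le_min_iff]; exact ⟨fun h => ⟨h, Finset.card_le_univ _⟩, fun h => h.1⟩
  simp only [this]

lemma loglev {s : ℕ} (hs : 2 ≤ s) : ((Nat.log 2 s + 1 : ℕ) : ℝ) ≤ 3 * Real.log s := by
  have h1 : 2 ^ Nat.log 2 s ≤ s := Nat.pow_log_le_self 2 (by omega)
  have h2 : (Nat.log 2 s : ℝ) * Real.log 2 ≤ Real.log s := by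
    rw [← Real.log_pow]
    exact Real.log_le_log (by positivity) (by exact_mod_cast h1)
  have h3 : Real.log 2 ≤ Real.log s := Real.log_le_log (by norm_num) (by exact_mod_cast hs)
  have h4 := Real.log_two_gt_d9
  push_cast
  have h5 : (0 : ℝ) ≤ Nat.log 2 s := by positivity
  nlinarith

lemma mean_bound {p n m s : ℕ} [NeZero m] (hp : 1 ≤ p) (hn : 2 ≤ n) (hnm : n ≤ m) (hs : 2 ≤ s)
    (hsN : s ≤ Fintype.card (Fin p × Fin n)) (hT : (snet (Fin p × Fin n) s).Nonempty)
    (B κ : ℝ) (hκ : 64 * Real.log (m * p) / m ≤ κ) (hκ0 : 0 < κ)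
    (hB : B = 324 * ((Nat.log 2 s + 1 : ℕ) : ℝ) * (√s * √(2 * Real.log (m * p)) *
      √(Real.log (Fintype.card (Fin p × Fin n)))))
    (ha : B * √κ ≤ 1 / 2) :
    ∫ ψ, ((snet (Fin p × Fin n) s).sup' hT fun x => |∑ a, x a ^ 2 - fen x ψ|) ∂(gaussMeasure p m)
      ≤ 4 * (B * √κ) := by
  set T := snet (Fin p × Fin n) s with hTdef
  set μ := gaussMeasure p m with hμ
  set M : (Fin p → Fin m → ℝ) → ℝ := fun ψ => T.sup' hT fun x => |∑ a, x a ^ 2 - fen x ψ| with hM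
  have hB0 : 0 ≤ B := by rw [hB]; positivity
  have hm2 : 2 ≤ m := hn.trans hnm
  have hmR : (2 : ℝ) ≤ m := by exact_mod_cast hm2
  have hpR : (1 : ℝ) ≤ p := by exact_mod_cast hp
  have hcard : 2 ≤ Fintype.card (Fin p × Fin n) := hs.trans hsN
  have hMI : Integrable M μ :=
    sup_int μ T hT (fun x ψ => ∑ a, x a ^ 2 - fen x ψ) (fun x ψ => ∑ a, x a ^ 2 + fen x ψ)
      (fun x => continuous_const.sub (fen_cont x))
      (fun x => (integrable_const _).add (fen_int x))
      (fun x ψ => by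
        have h1 := fen_nonneg x ψ
        have h2 : 0 ≤ ∑ a, x a ^ 2 := by positivity
        rw [abs_le]; constructor <;> linarith)
  have hRI : ∀ η : Fin m → Bool, Integrable (fun ψ => T.sup' hT fun x => |sen η x ψ|) μ := fun η =>
    sup_int μ T hT (fun x ψ => sen η x ψ) (fun x ψ => fen x ψ)
      (fun x => sen_cont η x) (fun x => fen_int x) (fun x ψ => sen_abs η x ψ)
  have hz : (0 : Fin p × Fin n → ℝ) ∈ T := zero_mem_snet hsN
  have hM0 : ∀ ψ, 0 ≤ M ψ := fun ψ => (abs_nonneg _).trans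
    (Finset.le_sup' (fun x => |∑ a, x a ^ 2 - fen x ψ|) hz)
  have hlogm : Real.log 2 ≤ Real.log (m * p) :=
    Real.log_le_log (by norm_num) (by nlinarith)
  have hlog2 := Real.log_two_gt_d9
  have h2m : Real.log (2 * Fintype.card (Fin m)) ≤ 2 * Real.log (m * p) := by
    rw [Fintype.card_fin, ← Real.log_rpow (by positivity)]
    apply Real.log_le_log (by positivity)
    have : (m : ℝ) ≤ m * p := le_mul_of_one_le_right (by positivity) hpR
    rw [Real.rpow_two]
    nlinarith
  set t : ℝ := 1 / √κ with ht
  have hsκ : 0 < √κ := Real.sqrt_pos.2 hκ0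
  have ht0 : 0 < t := by positivity
  have hpt : ∀ ψ, ∑ η : Fin m → Bool, (T.sup' hT fun x => |sen η x ψ|)
      ≤ 2 ^ m * (B * ((t * ksq ψ + (1 + M ψ) / t) / 2)) := by
    intro ψ
    have hk := ksq_pos hp hm2 ψ
    have hc := chaining (frep (m := m)) frep_fiber (fun w ik => vv n ψ w ik) T s
      (Nat.log 2 s + 1) (by omega)
      ((Nat.lt_pow_succ_log_self (by norm_num) s).le.trans (Nat.pow_le_pow_left (by norm_num) _))
      (√(ksq ψ)) (√s) (2 * Real.log (m * p)) (√(1 + M ψ))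
      (Real.sqrt_pos.2 hk) (Real.sqrt_pos.2 (by exact_mod_cast (by omega : 0 < s)))
      (fun w ik => vv_bound hp hm2 ψ w ik) (fun x hx => snet_l1 hx) hz hcard (by linarith)
      h2m (snet_card hsN hcard) (Real.sqrt_pos.2 (by linarith [hM0 ψ]))
      (fun x hx => by
        rw [Real.sq_sqrt (by linarith [hM0 ψ])]
        have h1 : |∑ a, x a ^ 2 - fen x ψ| ≤ M ψ :=
          Finset.le_sup' (fun x => |∑ a, x a ^ 2 - fen x ψ|) hx
        have h2 := (abs_le.1 h1).1
        have h3 := snet_l2 hx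
        have h4 : fen x ψ = ∑ w, (∑ ik, vv n ψ w ik * x ik) ^ 2 := energy_hblk ψ x
        linarith)
      (fun η => T.sup' hT fun x => |sen η x ψ|)
      (fun η => by
        obtain ⟨x, hx, h⟩ := T.exists_mem_eq_sup' hT fun x => |sen η x ψ|
        exact ⟨x, hx, h.le⟩)
    refine hc.trans ?_
    rw [Fintype.card_fin]
    refine mul_le_mul_of_nonneg_left ?_ (by positivity)
    have e : 324 * ((Nat.log 2 s + 1 : ℕ) : ℝ) * (√s * √(ksq ψ) * √(2 * Real.log (m * p)) *
        √(1 + M ψ) * √(Real.log (Fintype.card (Fin p × Fin n)))) = B * (√(ksq ψ) * √(1 + M ψ)) := by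
      rw [hB]; ring
    rw [e]
    refine mul_le_mul_of_nonneg_left ?_ hB0
    have hst : 0 < √t := Real.sqrt_pos.2 ht0
    have h1 := Real.sq_sqrt hk.le
    have h2 := Real.sq_sqrt (by linarith [hM0 ψ] : 0 ≤ 1 + M ψ)
    have h3 := Real.sq_sqrt ht0.le
    have h4 := sq_nonneg (√t * √(ksq ψ) - √(1 + M ψ) / √t)
    have h5 : (√t * √(ksq ψ) - √(1 + M ψ) / √t) ^ 2
        = √t ^ 2 * √(ksq ψ) ^ 2 + √(1 + M ψ) ^ 2 / √t ^ 2 - 2 * (√(ksq ψ) * √(1 + M ψ)) := by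
      field_simp; ring
    rw [h5, h1, h2, h3] at h4
    linarith
  have hsum : ∑ _η : Fin m → Bool, ∫ ψ, M ψ ∂μ
      ≤ ∑ η : Fin m → Bool, 2 * ∫ ψ, (T.sup' hT fun x => |sen η x ψ|) ∂μ :=
    Finset.sum_le_sum fun η _ => symm_ineq T hT hnm η
  rw [← Finset.mul_sum, ← integral_finsetSum _ fun η _ => hRI η] at hsum
  have hI2 : Integrable (fun ψ => 2 ^ m * (B * ((t * ksq ψ + (1 + M ψ) / t) / 2))) μ :=
    ((((ksq_int.const_mul t).add (((integrable_const 1).add hMI).div_const t)).div_const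
      2).const_mul B).const_mul _
  have hint := integral_mono (integrable_finsetSum Finset.univ fun η _ => hRI η) hI2 hpt
  have hJ1 : Integrable (fun ψ => t * ksq ψ) μ := ksq_int.const_mul t
  have hJ2 : Integrable (fun ψ => (1 + M ψ) / t) μ :=
    ((integrable_const 1).add hMI).div_const t
  have hval : ∫ ψ, 2 ^ m * (B * ((t * ksq ψ + (1 + M ψ) / t) / 2)) ∂μ
      = 2 ^ m * (B * ((t * ∫ ψ, ksq ψ ∂μ) + (1 + ∫ ψ, M ψ ∂μ) / t) / 2) := by
    rw [integral_const_mul, integral_const_mul, integral_div, integral_add hJ1 hJ2,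
      integral_const_mul, integral_div, integral_add (integrable_const 1) hMI]
    simp
    ring
  rw [hval] at hint
  have hk2 : ∫ ψ, ksq ψ ∂μ ≤ κ := (ksq_mean hp hm2).trans hκ
  rw [Finset.sum_const, Finset.card_univ, Fintype.card_fun, Fintype.card_bool, Fintype.card_fin,
    nsmul_eq_mul] at hsum
  push_cast at hsum
  set E := ∫ ψ, M ψ ∂μ with hE
  have hpow : (0 : ℝ) < 2 ^ m := by positivity
  have h1 : E ≤ B * ((t * ∫ ψ, ksq ψ ∂μ) + (1 + E) / t) := by
    have h : (2 : ℝ) ^ m * E ≤ 2 ^ m * (B * ((t * ∫ ψ, ksq ψ ∂μ) + (1 + E) / t)) := by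
      linarith
    exact le_of_mul_le_mul_left h hpow
  have h2 : t * ∫ ψ, ksq ψ ∂μ ≤ √κ := by
    have := mul_le_mul_of_nonneg_left hk2 ht0.le
    have e : t * κ = √κ := by
      rw [ht, div_mul_eq_mul_div, one_mul, Real.div_sqrt]
    linarith
  have h3 : (1 + E) / t = (1 + E) * √κ := by rw [ht]; field_simp
  rw [h3] at h1
  have h4 : B * ((t * ∫ ψ, ksq ψ ∂μ) + (1 + E) * √κ) ≤ B * (√κ + (1 + E) * √κ) :=
    mul_le_mul_of_nonneg_left (by linarith) hB0
  have hE0 : 0 ≤ E := integral_nonneg hM0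
  have h5 : B * (√κ + (1 + E) * √κ) = 2 * (B * √κ) + (B * √κ) * E := by ring
  have h6 : (B * √κ) * E ≤ 1 / 2 * E := mul_le_mul_of_nonneg_right ha hE0
  linarith

lemma core_bound {p n m s : ℕ} (hp : 1 ≤ p) (hn : 2 ≤ n) (hnm : n ≤ m) (hs : 2 ≤ s)
    (hsN : s ≤ Fintype.card (Fin p × Fin n)) (Y : ℝ)
    (hY : Y = 324 ^ 2 * 1152 * (s * (Real.log s) ^ 2 * (Real.log ((m : ℝ) * p)) ^ 2 *
      Real.log ((n : ℝ) * p)) / m) (hY1 : Y ≤ 1 / 4) :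
    ∫ φ, snormS s ((1 - (probeMatrix p n m φ)ᵀ * probeMatrix p n m φ).map Complex.ofReal)
      ∂(gaussMeasure p m) ≤ 64 * √Y := by
  have hm2 : 2 ≤ m := hn.trans hnm
  have hNZ : NeZero m := ⟨by omega⟩
  have hmR : (2 : ℝ) ≤ m := by exact_mod_cast hm2
  have hpR : (1 : ℝ) ≤ p := by exact_mod_cast hp
  have hnR : (2 : ℝ) ≤ n := by exact_mod_cast hn
  have hT : (snet (Fin p × Fin n) s).Nonempty := ⟨0, zero_mem_snet hsN⟩
  have hlogm : 0 < Real.log (m * p) := Real.log_pos (by nlinarith)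
  have hlogn : 0 < Real.log ((n : ℝ) * p) := Real.log_pos (by nlinarith)
  have hcard : ((Fintype.card (Fin p × Fin n) : ℕ) : ℝ) = n * p := by
    simp [mul_comm]
  set κ : ℝ := 64 * Real.log (m * p) / m with hκ
  have hκ0 : 0 < κ := by positivity
  set L : ℝ := ((Nat.log 2 s + 1 : ℕ) : ℝ) with hL
  set B : ℝ := 324 * L * (√s * √(2 * Real.log (m * p)) *
      √(Real.log (Fintype.card (Fin p × Fin n)))) with hB
  have hL0 : 0 ≤ L := by positivity
  have hLs : L ≤ 3 * Real.log s := loglev hs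
  have hBY : B * √κ ≤ √Y := by
    apply Real.le_sqrt_of_sq_le
    rw [hB, hcard, mul_pow, mul_pow, mul_pow, mul_pow, mul_pow, Real.sq_sqrt (by positivity),
      Real.sq_sqrt (by positivity), Real.sq_sqrt hlogn.le, Real.sq_sqrt hκ0.le, hY, hκ]
    have h1 : L ^ 2 ≤ 9 * Real.log s ^ 2 := by nlinarith
    have h2 : 0 ≤ 324 ^ 2 * ((s : ℝ) * (2 * Real.log (m * p)) * Real.log (n * p)) *
      (64 * Real.log (m * p) / m) := by positivity
    have h3 := mul_le_mul_of_nonneg_right h1 h2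
    calc _ = L ^ 2 * (324 ^ 2 * ((s : ℝ) * (2 * Real.log (m * p)) * Real.log (n * p)) *
      (64 * Real.log (m * p) / m)) := by ring
      _ ≤ _ := h3
      _ = _ := by ring
  have hsY : √Y ≤ 1 / 2 := by
    rw [Real.sqrt_le_left (by norm_num)]; linarith
  have hmb := mean_bound hp hn hnm hs hsN hT B κ le_rfl hκ0 hB (hBY.trans hsY)
  set T := snet (Fin p × Fin n) s with hTdef
  have hMI : Integrable (fun φ => T.sup' hT fun x => |∑ a, x a ^ 2 - energy φ x|)
      (gaussMeasure p m) :=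
    sup_int _ T hT (fun x φ => ∑ a, x a ^ 2 - energy φ x) (fun x φ => ∑ a, x a ^ 2 + energy φ x)
      (fun x => continuous_const.sub (energy_cont x))
      (fun x => (integrable_const _).add (energy_int x))
      (fun x φ => by
        have h1 : 0 ≤ energy φ x := by unfold energy; positivity
        have h2 : 0 ≤ ∑ a, x a ^ 2 := by positivity
        rw [abs_le]; constructor <;> linarith)
  have hmap : ∫ ψ, (T.sup' hT fun x => |∑ a, x a ^ 2 - fen x ψ|) ∂(gaussMeasure p m)
      = ∫ φ, (T.sup' hT fun x => |∑ a, x a ^ 2 - energy φ x|) ∂(gaussMeasure p m) := by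
    conv_rhs => rw [← (hblk_mp (p := p) (m := m)).map_eq]
    rw [integral_map hblk_mp.measurable.aemeasurable]
    · rfl
    · rw [hblk_mp.map_eq]; exact hMI.aestronglyMeasurable
  rw [hmap] at hmb
  have h1 : ∫ φ, snormS s ((1 - (probeMatrix p n m φ)ᵀ * probeMatrix p n m φ).map Complex.ofReal)
      ∂(gaussMeasure p m)
      ≤ ∫ φ, 16 * (T.sup' hT fun x => |∑ a, x a ^ 2 - energy φ x|) ∂(gaussMeasure p m) := by
    refine integral_mono_of_nonneg (Filter.Eventually.of_forall fun φ => snormS_nonneg _ _)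
      (hMI.const_mul 16) (Filter.Eventually.of_forall fun φ => ?_)
    refine snormS_le _ ?_ (by omega) hsN _ fun x hx => ?_
    · rw [Matrix.IsSymm, Matrix.transpose_sub, Matrix.transpose_mul, Matrix.transpose_transpose,
        Matrix.transpose_one]
    · rw [quad_energy]
      exact Finset.le_sup' (fun x => |∑ a, x a ^ 2 - energy φ x|) hx
  rw [integral_const_mul] at h1
  linarith

theorem stmt0 : ∃ C5 C6 : ℝ, 0 < C5 ∧ 0 < C6 ∧
    ∀ (p n m s : ℕ), 1 ≤ p → 2 ≤ n → n ≤ m → 2 ≤ s →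
    C6 * s * (Real.log s) ^ 2 * (Real.log ((m : ℝ) * p)) ^ 2 * Real.log ((n : ℝ) * p) ≤ m →
    (∫ φ, snormS s ((1 - (probeMatrix p n m φ)ᵀ * probeMatrix p n m φ).map Complex.ofReal)
        ∂(gaussMeasure p m))
      ≤ Real.sqrt (C5 * s * (Real.log s) ^ 2 * (Real.log ((m : ℝ) * p)) ^ 2 *
          Real.log ((n : ℝ) * p) / m) := by
  refine ⟨4096 * (324 ^ 2 * 1152), 4 * (324 ^ 2 * 1152), by norm_num, by norm_num, ?_⟩
  intro p n m s hp hn hnm hs hyp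
  have hm2 : 2 ≤ m := hn.trans hnm
  have hmR : (2 : ℝ) ≤ m := by exact_mod_cast hm2
  have hpR : (1 : ℝ) ≤ p := by exact_mod_cast hp
  have hnR : (2 : ℝ) ≤ n := by exact_mod_cast hn
  have hlogm : 0 < Real.log (m * p) := Real.log_pos (by nlinarith)
  have hlogn : 0 < Real.log ((n : ℝ) * p) := Real.log_pos (by nlinarith)
  set s' := min s (Fintype.card (Fin p × Fin n)) with hs'
  have hcard : 2 ≤ Fintype.card (Fin p × Fin n) := by
    rw [Fintype.card_prod, Fintype.card_fin, Fintype.card_fin]; nlinarith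
  have hs2 : 2 ≤ s' := le_min hs hcard
  have hs'R : (2 : ℝ) ≤ s' := by exact_mod_cast hs2
  have hss : (s' : ℝ) ≤ s := by exact_mod_cast min_le_left _ _
  have hlog0 : 0 < Real.log s' := Real.log_pos (by linarith)
  have hlogs : Real.log s' ≤ Real.log s := Real.log_le_log (by linarith) hss
  have hX : (s' : ℝ) * (Real.log s') ^ 2 * (Real.log ((m : ℝ) * p)) ^ 2 * Real.log ((n : ℝ) * p)
      ≤ s * (Real.log s) ^ 2 * (Real.log ((m : ℝ) * p)) ^ 2 * Real.log ((n : ℝ) * p) := by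
    gcongr
  have hm0 : (0 : ℝ) < m := by linarith
  have hc := core_bound hp hn hnm hs2 (min_le_right _ _) _ rfl (by
    rw [div_le_iff₀ hm0]; linarith)
  simp only [snormS_min s]
  refine hc.trans ?_
  rw [show (64 : ℝ) = √4096 by
    rw [show (4096 : ℝ) = 64 ^ 2 by norm_num, Real.sqrt_sq (by norm_num)],
    ← Real.sqrt_mul (by norm_num)]
  apply Real.sqrt_le_sqrt
  rw [← mul_div_assoc]
  gcongr ?_ / _
  linarith
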